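/- arXiv:1606.08485 — 6 statements merged into one kernel-verified Lean document; each statement's English description precedes it below -/
import Mathlib

section
/- Let G be a finite connected simple graph on 9 vertices with 2 ≤ δ(G) ≤ Δ(G) ≤ 3. If there exist vertices u₁, u₂, both of degree 3, and a vertex z with z ≠ u₁ and z ≠ u₂, such that N̄(u₁) ∩ N̄(u₂) = {z}, then c_L(G) ≤ 2. -/
/-!
Cops and robbers on a simple graph `G`.

A *configuration* consists of the positions of the `k` cops (a function
`Fin k → V`) together with the robber's position, with the cops to move.
The cops win if at some point a cop occupies the robber's vertex.
-/

namespace CopsRobbers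

variable {V : Type*}

/-- From cop positions `c` and robber position `r`, with the cops to move,
the cops (each of whom may move along an edge or stay put on the cops' turn)
can guarantee to catch the robber.  Either a cop is already on the robber,
or the cops can move so that a cop lands on the robber, or the cops can move
so that whatever (legal) move the robber then makes, the resulting
configuration is again winning for the cops. -/
inductive CopsWinFrom (G : SimpleGraph V) {k : ℕ} : (Fin k → V) → V → Prop
  | caught {c : Fin k → V} {r : V} (i : Fin k) (h : c i = r) : CopsWinFrom G c r
  | stepCatch {c : Fin k → V} {r : V} (c' : Fin k → V)
      (hmove : ∀ i, c' i = c i ∨ G.Adj (c i) (c' i))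
      (i : Fin k) (h : c' i = r) : CopsWinFrom G c r
  | step {c : Fin k → V} {r : V} (c' : Fin k → V)
      (hmove : ∀ i, c' i = c i ∨ G.Adj (c i) (c' i))
      (hnext : ∀ r', (r' = r ∨ G.Adj r r') → CopsWinFrom G c' r') :
      CopsWinFrom G c r

/-- `k` cops have a winning strategy on `G` in the ordinary game: they choose
starting positions, and then whatever vertex the robber starts on, they can
catch him. -/
def CopsWin (G : SimpleGraph V) (k : ℕ) : Prop :=
  ∃ c₀ : Fin k → V, ∀ r₀ : V, CopsWinFrom G c₀ r₀

/-- The cop number `c(G)`: the least number of cops that have a winning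
strategy on `G`. -/
noncomputable def copNumber (G : SimpleGraph V) : ℕ :=
  sInf {k | CopsWin G k}

/-- The lazy variant: from cop positions `c` and robber position `r`, with the
cops to move, the cops can catch the robber, where on each cops' turn at most
one cop (cop `j`) moves along an edge (all others stay put). -/
inductive LazyWinFrom (G : SimpleGraph V) {k : ℕ} : (Fin k → V) → V → Prop
  | caught {c : Fin k → V} {r : V} (i : Fin k) (h : c i = r) : LazyWinFrom G c r
  | stepCatch {c : Fin k → V} {r : V} (c' : Fin k → V) (j : Fin k)
      (hmove : c' j = c j ∨ G.Adj (c j) (c' j))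
      (hfix : ∀ i, i ≠ j → c' i = c i)
      (i : Fin k) (h : c' i = r) : LazyWinFrom G c r
  | step {c : Fin k → V} {r : V} (c' : Fin k → V) (j : Fin k)
      (hmove : c' j = c j ∨ G.Adj (c j) (c' j))
      (hfix : ∀ i, i ≠ j → c' i = c i)
      (hnext : ∀ r', (r' = r ∨ G.Adj r r') → LazyWinFrom G c' r') :
      LazyWinFrom G c r

/-- `k` lazy cops have a winning strategy on `G`. -/
def LazyCopsWin (G : SimpleGraph V) (k : ℕ) : Prop :=
  ∃ c₀ : Fin k → V, ∀ r₀ : V, LazyWinFrom G c₀ r₀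

/-- The lazy cop number `c_L(G)`. -/
noncomputable def lazyCopNumber (G : SimpleGraph V) : ℕ :=
  sInf {k | LazyCopsWin G k}

/-- A dominating set: every vertex is in `S` or adjacent to a member of `S`. -/
def IsDominatingSet (G : SimpleGraph V) (S : Set V) : Prop :=
  ∀ v : V, v ∈ S ∨ ∃ u ∈ S, G.Adj u v

/-- The domination number `γ(G)`: the least size of a dominating set. -/
noncomputable def dominationNumber (G : SimpleGraph V) [Fintype V] : ℕ :=
  sInf {m | ∃ S : Finset V, S.card = m ∧ IsDominatingSet G ↑S}

/-- The `n × n` rooks graph `K_n □ K_n`. -/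
def rooksGraph (n : ℕ) : SimpleGraph (Fin n × Fin n) :=
  SimpleGraph.boxProd ⊤ ⊤


/-! ### Relations on `{0, …, 8}` stored as bit masks -/

/-- The mask `m`, read as a relation on `{0, …, 8}`, holds at `(x, y)`. -/
def hasPair (m x y : ℕ) : Bool :=
  Nat.beq (Nat.land (Nat.shiftRight m (Nat.add (Nat.mul 9 x) y)) 1) 1

/-- The mask `m` with the pairs `(x, y)` and `(y, x)` added. -/
def addPair (m x y : ℕ) : ℕ :=
  Nat.lor m (Nat.lor (Nat.pow 2 (Nat.add (Nat.mul 9 x) y)) (Nat.pow 2 (Nat.add (Nat.mul 9 y) x)))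

/-- The mask `m` with all pairs of the list `es` added symmetrically. -/
def addPairs (m : ℕ) (es : List (ℕ × ℕ)) : ℕ :=
  es.foldl (fun m e => addPair m e.1 e.2) m

/-- The nine labels. -/
def labels : List ℕ := [0, 1, 2, 3, 4, 5, 6, 7, 8]

theorem mem_labels {x : ℕ} : x ∈ labels ↔ x < 9 := by
  simp only [labels, List.mem_cons, List.not_mem_nil, or_false]
  omega

theorem nodup_labels : labels.Nodup := by decide

theorem hasPair_eq_testBit (m x y : ℕ) : hasPair m x y = m.testBit (9 * x + y) := by
  have h : hasPair m x y = Nat.beq ((m >>> (9 * x + y)) &&& 1) 1 := rfl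
  rw [h, Nat.testBit, Nat.and_comm, Nat.and_comm 1]
  rcases Nat.mod_two_eq_zero_or_one (m >>> (9 * x + y)) with h | h
  · simp [Nat.and_comm, h]
    rfl
  · simp [Nat.and_comm, h]

/-- In the masks `m`, `m'`, `m''`, the row of `x`, the row of `y` and the row of `z` together cover
all labels. -/
def rowsCover (m x m' y m'' z : ℕ) : Bool :=
  Nat.beq (Nat.land (Nat.lor (Nat.shiftRight m (Nat.mul 9 x))
    (Nat.lor (Nat.shiftRight m' (Nat.mul 9 y)) (Nat.shiftRight m'' (Nat.mul 9 z)))) 511) 511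

theorem hasPair_of_rowsCover {m x m' y m'' z : ℕ} (h : rowsCover m x m' y m'' z = true) {s : ℕ}
    (hs : s < 9) : hasPair m x s = true ∨ hasPair m' y s = true ∨ hasPair m'' z s = true := by
  have h' : ((m >>> (9 * x)) ||| ((m' >>> (9 * y)) ||| (m'' >>> (9 * z)))) &&& 511 = 511 :=
    Nat.eq_of_beq_eq_true h
  have h511 : Nat.testBit 511 s = true := by
    interval_cases s <;> rfl
  have := congrArg (Nat.testBit · s) h'
  simpa [hasPair_eq_testBit, Nat.testBit_and, Nat.testBit_or, Nat.testBit_shiftRight, h511]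
    using this

theorem hasPair_addPair {m i j x y : ℕ} (hi : i < 9) (hj : j < 9) (hy : y < 9) :
    hasPair (addPair m i j) x y = true ↔
      hasPair m x y = true ∨ (x = i ∧ y = j) ∨ (x = j ∧ y = i) := by
  have h : addPair m i j = m ||| (2 ^ (9 * i + j) ||| 2 ^ (9 * j + i)) := rfl
  simp only [hasPair_eq_testBit, h, Nat.testBit_or, Nat.testBit_two_pow, Bool.or_eq_true,
    decide_eq_true_eq]
  refine or_congr_right (or_congr ?_ ?_) <;> omega

/-! ### Winning positions in a partially known graph

In what follows the mask `Y` records pairs of labels known to be equal or adjacent, and `N` records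
pairs known to be neither. -/

/-- Two lazy cops at `a` and `b` catch a robber at `r` within `n + 2` rounds, using only edges in
`Y` and allowing the robber every step outside `N`; some cop moves in each of the first `n + 1`
rounds. -/
def catches (Y N : ℕ) : ℕ → ℕ → ℕ → ℕ → Bool
  | 0, a, b, r => hasPair Y a r || (hasPair Y b r ||
      (labels.any (fun x => (hasPair Y a x && !Nat.beq a x) && rowsCover N r Y x Y b) ||
        labels.any (fun x => (hasPair Y b x && !Nat.beq b x) && rowsCover N r Y a Y x)))
  | n + 1, a, b, r => hasPair Y a r || (hasPair Y b r ||
      (labels.any (fun x => (hasPair Y a x && !Nat.beq a x) && labels.all fun s =>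
          hasPair N r s || catches Y N n x b s) ||
        labels.any (fun x => (hasPair Y b x && !Nat.beq b x) && labels.all fun s =>
          hasPair N r s || catches Y N n a x s)))

/-- Cops starting at `0` and `1` win within `n + 2` rounds, whatever the robber's starting point. -/
def startWins (Y N n : ℕ) : Bool := labels.all (catches Y N n 0 1)

/-- No graph compatible with `Y` and `N` has all degrees equal to `2` or `3`. -/
def degreeViolation (Y N : ℕ) : Bool :=
  labels.any fun x => Nat.blt 4 (labels.filter (hasPair Y x)).length ||
    Nat.blt (labels.filter fun y => !hasPair N x y).length 3

/-- Decide the pairs of the list one after the other, in both ways, until a degree is violated or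
the cops win. The third component of a list entry bounds the search tried before splitting on
its pair. -/
def everyCompletionWins : List (ℕ × ℕ × ℕ) → ℕ → ℕ → Bool
  | [], Y, N => degreeViolation Y N || startWins Y N 3
  | (i, j, n) :: es, Y, N => degreeViolation Y N || (startWins Y N n ||
      (everyCompletionWins es Y (addPair N i j) && everyCompletionWins es (addPair Y i j) N))

/-- The edges known at the outset. -/
def initialEdges : List (ℕ × ℕ) := [(0, 2), (0, 3), (0, 4), (1, 2), (1, 5), (1, 6)]

/-- The non-edges known at the outset. -/
def initialNonEdges : List (ℕ × ℕ) :=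
  [(0, 1), (0, 5), (0, 6), (0, 7), (0, 8), (1, 3), (1, 4), (1, 7), (1, 8)]

/-- The remaining pairs, each with a search depth. -/
def undeterminedPairs : List (ℕ × ℕ × ℕ) :=
  [(6, 8, 0), (5, 7, 0), (5, 8, 0), (6, 7, 0), (7, 8, 2), (3, 8, 1), (4, 8, 0), (3, 7, 0),
    (4, 7, 0), (2, 7, 2), (2, 8, 3), (4, 6, 0), (3, 6, 0), (4, 5, 2), (3, 5, 0), (2, 3, 2),
    (3, 4, 1), (5, 6, 0), (2, 4, 2), (2, 5, 3), (2, 6, 3)]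

/-- The mask of the equality relation. -/
def diagonal : ℕ :=
  2 ^ 0 + 2 ^ 10 + 2 ^ 20 + 2 ^ 30 + 2 ^ 40 + 2 ^ 50 + 2 ^ 60 + 2 ^ 70 + 2 ^ 80

theorem everyCompletionWins_initial :
    everyCompletionWins undeterminedPairs (addPairs diagonal initialEdges)
      (addPairs 0 initialNonEdges) = true := by
  decide +kernel

/-! ### Soundness -/

/-- The masks `Y` and `N` are correct for the graph `G` labelled by `f`. -/
structure Compatible (G : SimpleGraph V) (f : ℕ → V) (Y N : ℕ) : Prop where
  edge : ∀ x < 9, ∀ y < 9, hasPair Y x y = true → f y = f x ∨ G.Adj (f x) (f y)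
  nonEdge : ∀ x < 9, ∀ y < 9, hasPair N x y = true → ¬(f y = f x ∨ G.Adj (f x) (f y))

theorem Compatible.diagonal_zero (G : SimpleGraph V) (f : ℕ → V) :
    Compatible G f diagonal 0 where
  edge x hx y hy h := by
    have key : ∀ x < 9, ∀ y < 9, hasPair diagonal x y = true → y = x := by decide
    exact Or.inl (congrArg f (key x hx y hy h))
  nonEdge x hx y hy h := by
    simp [hasPair_eq_testBit] at h

theorem Compatible.addEdge {G : SimpleGraph V} {f : ℕ → V} {Y N i j : ℕ}
    (h : Compatible G f Y N) (hi : i < 9) (hj : j < 9) (hij : G.Adj (f i) (f j)) :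
    Compatible G f (addPair Y i j) N where
  edge x hx y hy hxy := by
    rcases (hasPair_addPair hi hj hy).1 hxy with hxy | ⟨rfl, rfl⟩ | ⟨rfl, rfl⟩
    exacts [h.edge x hx y hy hxy, Or.inr hij, Or.inr hij.symm]
  nonEdge := h.nonEdge

theorem Compatible.addNonEdge {G : SimpleGraph V} {f : ℕ → V} {Y N i j : ℕ}
    (h : Compatible G f Y N) (hi : i < 9) (hj : j < 9) (hne : f i ≠ f j)
    (hij : ¬G.Adj (f i) (f j)) : Compatible G f Y (addPair N i j) where
  edge := h.edge
  nonEdge x hx y hy hxy := by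
    rcases (hasPair_addPair hi hj hy).1 hxy with hxy | ⟨rfl, rfl⟩ | ⟨rfl, rfl⟩
    · exact h.nonEdge x hx y hy hxy
    · exact not_or.2 ⟨hne.symm, hij⟩
    · exact not_or.2 ⟨hne, fun h => hij h.symm⟩

theorem Compatible.addEdges {G : SimpleGraph V} {f : ℕ → V} {N : ℕ} {es : List (ℕ × ℕ)} {Y : ℕ}
    (h : Compatible G f Y N)
    (hes : ∀ e ∈ es, e.1 < 9 ∧ e.2 < 9 ∧ G.Adj (f e.1) (f e.2)) :
    Compatible G f (addPairs Y es) N := by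
  induction es generalizing Y with
  | nil => exact h
  | cons e es ih =>
    obtain ⟨hi, hj, hij⟩ := hes e (by simp)
    exact ih (h.addEdge hi hj hij) fun e' he' => hes e' (by simp [he'])

theorem Compatible.addNonEdges {G : SimpleGraph V} {f : ℕ → V} {Y : ℕ} {es : List (ℕ × ℕ)} {N : ℕ}
    (h : Compatible G f Y N)
    (hes : ∀ e ∈ es, e.1 < 9 ∧ e.2 < 9 ∧ f e.1 ≠ f e.2 ∧ ¬G.Adj (f e.1) (f e.2)) :
    Compatible G f Y (addPairs N es) := by
  induction es generalizing N with
  | nil => exact h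
  | cons e es ih =>
    obtain ⟨hi, hj, hne, hij⟩ := hes e (by simp)
    exact ih (h.addNonEdge hi hj hne hij) fun e' he' => hes e' (by simp [he'])

theorem Compatible.lazyWinFrom_of_near {G : SimpleGraph V} {f : ℕ → V} {Y N a b r : ℕ}
    (h : Compatible G f Y N) (ha : a < 9) (hb : b < 9) (hr : r < 9)
    (hY : hasPair Y a r = true ∨ hasPair Y b r = true) : LazyWinFrom G ![f a, f b] (f r) := by
  rcases hY with hY | hY
  · exact .stepCatch ![f r, f b] 0 (by simpa using h.edge a ha r hr hY)
      (by simp [Fin.forall_fin_two]) 0 rfl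
  · exact .stepCatch ![f a, f r] 1 (by simpa using h.edge b hb r hr hY)
      (by simp [Fin.forall_fin_two]) 1 rfl

theorem Compatible.lazyWinFrom_of_move {G : SimpleGraph V} {f : ℕ → V} {Y N a b r : ℕ}
    (h : Compatible G f Y N) (hf : ∀ v, ∃ x < 9, f x = v) (ha : a < 9) (hb : b < 9) (hr : r < 9)
    (hmove : (∃ x < 9, hasPair Y a x = true ∧
        ∀ s < 9, hasPair N r s = true ∨ LazyWinFrom G ![f x, f b] (f s)) ∨
      ∃ x < 9, hasPair Y b x = true ∧
        ∀ s < 9, hasPair N r s = true ∨ LazyWinFrom G ![f a, f x] (f s)) :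
    LazyWinFrom G ![f a, f b] (f r) := by
  have robber : ∀ {P : V → Prop}, (∀ s < 9, hasPair N r s = true ∨ P (f s)) →
      ∀ r', (r' = f r ∨ G.Adj (f r) r') → P r' := by
    intro P hP r' hr'
    obtain ⟨s, hs, rfl⟩ := hf r'
    exact (hP s hs).resolve_left fun hN => h.nonEdge r hr s hs hN hr'
  rcases hmove with ⟨x, hx, hY, hs⟩ | ⟨x, hx, hY, hs⟩
  · exact .step ![f x, f b] 0 (by simpa using h.edge a ha x hx hY)
      (by simp [Fin.forall_fin_two]) (robber hs)
  · exact .step ![f a, f x] 1 (by simpa using h.edge b hb x hx hY)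
      (by simp [Fin.forall_fin_two]) (robber hs)

theorem Compatible.lazyWinFrom {G : SimpleGraph V} {f : ℕ → V} {Y N : ℕ}
    (h : Compatible G f Y N) (hf : ∀ v, ∃ x < 9, f x = v) (n : ℕ) {a b r : ℕ}
    (ha : a < 9) (hb : b < 9) (hr : r < 9) (hwin : catches Y N n a b r = true) :
    LazyWinFrom G ![f a, f b] (f r) := by
  induction n generalizing a b r with
  | zero =>
    simp only [catches, Bool.or_eq_true, Bool.and_eq_true, List.any_eq_true, mem_labels,
      ← or_assoc (a := hasPair Y a r = true)] at hwin
    refine hwin.elim (h.lazyWinFrom_of_near ha hb hr) fun hmove =>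
      h.lazyWinFrom_of_move hf ha hb hr (hmove.imp ?_ ?_)
    · rintro ⟨x, hx, ⟨hY, -⟩, hs⟩
      exact ⟨x, hx, hY, fun s hs9 => (hasPair_of_rowsCover hs hs9).imp_right
        (h.lazyWinFrom_of_near hx hb hs9)⟩
    · rintro ⟨x, hx, ⟨hY, -⟩, hs⟩
      exact ⟨x, hx, hY, fun s hs9 => (hasPair_of_rowsCover hs hs9).imp_right
        (h.lazyWinFrom_of_near ha hx hs9)⟩
  | succ n ih =>
    simp only [catches, Bool.or_eq_true, Bool.and_eq_true, List.any_eq_true, List.all_eq_true,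
      mem_labels, ← or_assoc (a := hasPair Y a r = true)] at hwin
    refine hwin.elim (h.lazyWinFrom_of_near ha hb hr) fun hmove =>
      h.lazyWinFrom_of_move hf ha hb hr (hmove.imp ?_ ?_)
    · rintro ⟨x, hx, ⟨hY, -⟩, hs⟩
      exact ⟨x, hx, hY, fun s hs9 => (hs s hs9).imp_right (ih hx hb hs9)⟩
    · rintro ⟨x, hx, ⟨hY, -⟩, hs⟩
      exact ⟨x, hx, hY, fun s hs9 => (hs s hs9).imp_right (ih ha hx hs9)⟩

theorem Compatible.degreeViolation_eq_false [Fintype V] {G : SimpleGraph V} [DecidableRel G.Adj]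
    {f : ℕ → V} {Y N : ℕ} (h : Compatible G f Y N) (hf : ∀ v, ∃ x < 9, f x = v)
    (hinj : Set.InjOn f (Set.Iio 9)) (hδ : 2 ≤ G.minDegree) (hΔ : G.maxDegree ≤ 3) :
    degreeViolation Y N = false := by
  classical
  by_contra hv
  simp only [degreeViolation, Bool.not_eq_false, List.any_eq_true, Bool.or_eq_true, mem_labels,
    Nat.blt_eq] at hv
  obtain ⟨x, hx, hv⟩ := hv
  have hcard : (insert (f x) (G.neighborFinset (f x))).card = G.degree (f x) + 1 := by
    rw [Finset.card_insert_of_notMem (by simp), SimpleGraph.card_neighborFinset_eq_degree]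
  have hlow := G.minDegree_le_degree (f x)
  have hupp := G.degree_le_maxDegree (f x)
  have hfilter : ∀ p : ℕ → Bool,
      (labels.filter p).length = (labels.filter p).toFinset.card := fun p =>
    (List.toFinset_card_of_nodup (nodup_labels.filter p)).symm
  rcases hv with hv | hv
  · have : (labels.filter (hasPair Y x)).toFinset.card ≤
        (insert (f x) (G.neighborFinset (f x))).card := by
      refine Finset.card_le_card_of_injOn f (fun y hy => ?_) (hinj.mono fun y hy => ?_)
      · simp only [List.coe_toFinset, List.mem_filter, mem_labels, Set.mem_ofPred_eq] at hy
        simpa using h.edge x hx y hy.1 hy.2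
      · simp only [List.coe_toFinset, List.mem_filter, mem_labels, Set.mem_ofPred_eq] at hy
        exact hy.1
    rw [hfilter] at hv
    omega
  · have : insert (f x) (G.neighborFinset (f x)) ⊆
        (labels.filter fun y => !hasPair N x y).toFinset.image f := by
      intro v hv
      obtain ⟨y, hy, rfl⟩ := hf v
      refine Finset.mem_image_of_mem f ?_
      simp only [Finset.mem_insert, SimpleGraph.mem_neighborFinset] at hv
      simp only [List.mem_toFinset, List.mem_filter, mem_labels, Bool.not_eq_true']
      exact ⟨hy, Bool.eq_false_iff.2 fun hN => h.nonEdge x hx y hy hN hv⟩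
    have := (Finset.card_le_card this).trans Finset.card_image_le
    rw [hfilter] at hv
    omega

theorem Compatible.lazyCopsWin_of_startWins {G : SimpleGraph V} {f : ℕ → V} {Y N n : ℕ}
    (h : Compatible G f Y N) (hf : ∀ v, ∃ x < 9, f x = v) (hwin : startWins Y N n = true) :
    LazyCopsWin G 2 := by
  refine ⟨![f 0, f 1], fun v => ?_⟩
  obtain ⟨r, hr, rfl⟩ := hf v
  exact h.lazyWinFrom hf n (by simp) (by simp) hr
    (List.all_eq_true.1 hwin r (mem_labels.2 hr))

theorem Compatible.lazyCopsWin [Fintype V] {G : SimpleGraph V} [DecidableRel G.Adj] {f : ℕ → V}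
    (hf : ∀ v, ∃ x < 9, f x = v) (hinj : Set.InjOn f (Set.Iio 9)) (hδ : 2 ≤ G.minDegree)
    (hΔ : G.maxDegree ≤ 3) {es : List (ℕ × ℕ × ℕ)}
    (hes : ∀ e ∈ es, e.1 < 9 ∧ e.2.1 < 9 ∧ e.1 ≠ e.2.1) {Y N : ℕ} (h : Compatible G f Y N)
    (hwin : everyCompletionWins es Y N = true) : LazyCopsWin G 2 := by
  induction es generalizing Y N with
  | nil =>
    rw [everyCompletionWins, h.degreeViolation_eq_false hf hinj hδ hΔ, Bool.false_or] at hwin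
    exact h.lazyCopsWin_of_startWins hf hwin
  | cons e es ih =>
    obtain ⟨i, j, n⟩ := e
    obtain ⟨hi, hj, hij⟩ := hes _ (List.mem_cons_self ..)
    rw [everyCompletionWins, h.degreeViolation_eq_false hf hinj hδ hΔ, Bool.false_or,
      Bool.or_eq_true, Bool.and_eq_true] at hwin
    have hes' : ∀ e ∈ es, e.1 < 9 ∧ e.2.1 < 9 ∧ e.1 ≠ e.2.1 := fun e he =>
      hes e (List.mem_cons_of_mem _ he)
    rcases hwin with hwin | ⟨hno, hyes⟩
    · exact h.lazyCopsWin_of_startWins hf hwin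
    · by_cases hadj : G.Adj (f i) (f j)
      · exact ih hes' (h.addEdge hi hj hadj) hyes
      · exact ih hes' (h.addNonEdge hi hj (hinj.ne hi hj hij) hadj) hno

/-- The other two neighbours of a vertex of degree three with a given neighbour. -/
theorem exists_neighbors_of_degree_eq_three [Fintype V] {G : SimpleGraph V} [DecidableRel G.Adj]
    {u z : V} (hu : G.degree u = 3) (hz : G.Adj u z) :
    ∃ a b, a ≠ b ∧ a ≠ z ∧ b ≠ z ∧ ∀ v, G.Adj u v ↔ v = z ∨ v = a ∨ v = b := by
  classical
  have hcard : ((G.neighborFinset u).erase z).card = 2 := by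
    rw [Finset.card_erase_of_mem (by simpa using hz), SimpleGraph.card_neighborFinset_eq_degree, hu]
  obtain ⟨a, b, hab, hs⟩ := Finset.card_eq_two.1 hcard
  have hs' : ∀ v, v ≠ z ∧ G.Adj u v ↔ v = a ∨ v = b := fun v => by
    simpa using Finset.ext_iff.1 hs v
  have ha := (hs' a).2 (Or.inl rfl)
  have hb := (hs' b).2 (Or.inr rfl)
  refine ⟨a, b, hab, ha.1, hb.1, fun v => ?_⟩
  rw [← hs']
  by_cases hv : v = z
  · simp [hv, hz]
  · simp [hv]

/-- 9 vertices, `2 ≤ δ(G) ≤ Δ(G) ≤ 3`, and two degree-3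
vertices whose closed neighborhoods intersect exactly in one vertex `z`
(distinct from both) imply `c_L(G) ≤ 2`. -/
theorem lazy_le_two_of_closed_neighborhoods_inter_singleton
    {V : Type*} [Fintype V] [Nonempty V] (G : SimpleGraph V)
    [DecidableRel G.Adj] (hconn : G.Connected)
    (hcard : Fintype.card V = 9)
    (hδ : 2 ≤ G.minDegree) (hΔ : G.maxDegree ≤ 3)
    (u₁ u₂ : V) (h1 : G.degree u₁ = 3) (h2 : G.degree u₂ = 3)
    (z : V) (hz1 : z ≠ u₁) (hz2 : z ≠ u₂)
    (hN : insert u₁ (G.neighborSet u₁) ∩ insert u₂ (G.neighborSet u₂) =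
      {z}) :
    lazyCopNumber G ≤ 2 := by
  classical
  have hmem : ∀ v, (v = u₁ ∨ G.Adj u₁ v) ∧ (v = u₂ ∨ G.Adj u₂ v) ↔ v = z := fun v => by
    simpa using Set.ext_iff.1 hN v
  obtain ⟨hz1', hz2'⟩ := (hmem z).2 rfl
  obtain ⟨a, b, hab, haz, hbz, hN1⟩ :=
    exists_neighbors_of_degree_eq_three h1 (hz1'.resolve_left hz1)
  obtain ⟨c, d, hcd, hcz, hdz, hN2⟩ :=
    exists_neighbors_of_degree_eq_three h2 (hz2'.resolve_left hz2)
  have hu1 : ∀ v, G.Adj u₁ v → v ≠ u₁ := fun v h => h.ne'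
  have hu2 : ∀ v, G.Adj u₂ v → v ≠ u₂ := fun v h => h.ne'
  simp only [hN1, hN2] at hmem hu1 hu2
  have hnodup : [u₁, u₂, z, a, b, c, d].Nodup := by
    simp only [List.nodup_cons, List.mem_cons, List.not_mem_nil, or_false, not_or]
    have := hmem u₁
    have := hmem u₂
    have := hmem a
    have := hmem b
    grind
  have hrest : (([u₁, u₂, z, a, b, c, d].toFinset)ᶜ).card = 2 := by
    rw [Finset.card_compl, List.toFinset_card_of_nodup hnodup, hcard]
    rfl
  obtain ⟨w, w', hww', hrest⟩ := Finset.card_eq_two.1 hrest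
  have hrest' : ∀ v, v ∉ [u₁, u₂, z, a, b, c, d] ↔ v = w ∨ v = w' := fun v => by
    simpa using Finset.ext_iff.1 hrest v
  have hw := (hrest' w).2 (Or.inl rfl)
  have hw' := (hrest' w').2 (Or.inr rfl)
  set l : List V := [u₁, u₂, z, a, b, c, d, w, w'] with hl
  have hlnodup : l.Nodup := by
    have : l = [u₁, u₂, z, a, b, c, d] ++ [w, w'] := rfl
    rw [this, List.nodup_append]
    refine ⟨hnodup, by simpa using hww', ?_⟩
    rintro x hx y hy rfl
    simp only [List.mem_cons, List.not_mem_nil, or_false] at hy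
    rcases hy with rfl | rfl
    exacts [hw hx, hw' hx]
  have hllength : l.length = 9 := rfl
  have hlmem : ∀ v, v ∈ l := fun v => by
    have := hrest' v
    simp only [hl, List.mem_cons, List.not_mem_nil, or_false] at this ⊢
    tauto
  set f : ℕ → V := fun n => l.getD n u₁ with hfdef
  have hf : ∀ v, ∃ x < 9, f x = v := fun v => by
    obtain ⟨x, hx, hxv⟩ := List.getElem_of_mem (hlmem v)
    exact ⟨x, hx, by simp only [hfdef, List.getD_eq_getElem _ _ hx, hxv]⟩
  have hinj : Set.InjOn f (Set.Iio 9) := by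
    intro x hx y hy hxy
    simp only [hfdef, List.getD_eq_getElem _ _ (show x < l.length from hx),
      List.getD_eq_getElem _ _ (show y < l.length from hy)] at hxy
    exact (hlnodup.getElem_inj_iff).1 hxy
  have hedges : ∀ e ∈ initialEdges, e.1 < 9 ∧ e.2 < 9 ∧ G.Adj (f e.1) (f e.2) := by
    simp [initialEdges, hfdef, hl, hN1, hN2]
  have hnonEdges : ∀ e ∈ initialNonEdges,
      e.1 < 9 ∧ e.2 < 9 ∧ f e.1 ≠ f e.2 ∧ ¬G.Adj (f e.1) (f e.2) := by
    have hlt : ∀ e ∈ initialNonEdges, e.1 < 9 ∧ e.2 < 9 ∧ e.1 ≠ e.2 := by decide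
    have hadj : ∀ e ∈ initialNonEdges, ¬G.Adj (f e.1) (f e.2) := by
      simp only [List.mem_cons, List.not_mem_nil, or_false, not_or] at hw hw'
      simp [initialNonEdges, hfdef, hl, hN1, hN2]
      grind
    intro e he
    obtain ⟨hi, hj, hij⟩ := hlt e he
    exact ⟨hi, hj, hinj.ne hi hj hij, hadj e he⟩
  exact Nat.sInf_le (Compatible.lazyCopsWin hf hinj hδ hΔ (by decide)
    (((Compatible.diagonal_zero G f).addEdges hedges).addNonEdges hnonEdges)
    everyCompletionWins_initial)

end CopsRobbers
end

section
/- Let G be a finite connected simple graph on 9 vertices with 2 ≤ δ(G) ≤ Δ(G) ≤ 3. If there exist vertices u₁, u₂, both of degree 3, and distinct vertices y, z, both different from u₁ and u₂, such that N̄(u₁) ∩ N̄(u₂) = {y, z} (i.e., u₁ and u₂ are nonadjacent and have exactly two common neighbors), then c_L(G) ≤ 2. -/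
/-!
Cops and robbers on a simple graph `G`.

A *configuration* consists of the positions of the `k` cops (a function
`Fin k → V`) together with the robber's position, with the cops to move.
The cops win if at some point a cop occupies the robber's vertex.
-/

namespace CopsRobbers

variable {V : Type*}

theorem lazyWinFrom_of_mem_closed_neighborhood {V : Type*} {G : SimpleGraph V} {c d r : V}
    (h : (c = r ∨ G.Adj c r) ∨ (d = r ∨ G.Adj d r)) : LazyWinFrom G ![c, d] r := by
  rcases h with h | h
  · exact .stepCatch ![r, d] 0 (by simpa [eq_comm] using h) (by simp) 0 (by simp)
  · exact .stepCatch ![c, r] 1 (by simpa [eq_comm] using h) (by simp) 1 (by simp)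

/-- The natural number with the given binary digits, least significant first. -/
def encodeBits : List Bool → ℕ
  | [] => 0
  | b :: l => b.toNat + 2 * encodeBits l

theorem testBit_encodeBits (l : List Bool) (i : ℕ) :
    (encodeBits l).testBit i = l.getD i false := by
  induction l generalizing i with
  | nil => simp [encodeBits]
  | cons b l ih =>
    cases i with
    | zero => cases b <;> simp [encodeBits, Nat.testBit_zero]
    | succ i =>
      have h : (b.toNat + 2 * encodeBits l) / 2 = encodeBits l := by cases b <;> simp; omega
      simp [encodeBits, Nat.testBit_succ, h, ih]

/-- The entries of a row-major `9 × 9` Boolean matrix packed into a number. -/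
def entry (g : ℕ) (i j : Fin 9) : Bool :=
  (Nat.land 1 (Nat.shiftRight g (Nat.add (Nat.mul 9 i.1) j.1))).beq 1

/-- The `i`-th row of the matrix packed into `g`. -/
def row (g : ℕ) (i : Fin 9) : ℕ := Nat.mod (Nat.shiftRight g (Nat.mul 9 i.1)) 512

/-- Row `r` is covered by rows `c` and `d`. -/
def covered (g : ℕ) (c d r : Fin 9) : Bool :=
  (row g r).beq (Nat.land (Nat.lor (row g c) (row g d)) (row g r))

/-- A Boolean existential quantifier over `Fin 9`, unrolled for fast kernel reduction. -/
def anyVertex (f : Fin 9 → Bool) : Bool :=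
  f ⟨0, by decide⟩ || (f ⟨1, by decide⟩ || (f ⟨2, by decide⟩ || (f ⟨3, by decide⟩ ||
    (f ⟨4, by decide⟩ || (f ⟨5, by decide⟩ || (f ⟨6, by decide⟩ || (f ⟨7, by decide⟩ ||
      f ⟨8, by decide⟩)))))))

/-- A Boolean universal quantifier over `Fin 9`, unrolled for fast kernel reduction. -/
def allVertex (f : Fin 9 → Bool) : Bool :=
  f ⟨0, by decide⟩ && (f ⟨1, by decide⟩ && (f ⟨2, by decide⟩ && (f ⟨3, by decide⟩ &&
    (f ⟨4, by decide⟩ && (f ⟨5, by decide⟩ && (f ⟨6, by decide⟩ && (f ⟨7, by decide⟩ &&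
      f ⟨8, by decide⟩)))))))

/-- Two lazy cops at `c` and `d` catch a robber at `r` after at most one preparatory move. -/
def dominationTest (g : ℕ) (c d r : Fin 9) : Bool :=
  (entry g c r || entry g d r) ||
    (anyVertex (fun x => entry g c x && covered g x d r) ||
      anyVertex (fun x => entry g d x && covered g c x r))

/-- Two lazy cops at `c` and `d` catch a robber at `r` after at most two preparatory moves. -/
def lazyTest (g : ℕ) (c d r : Fin 9) : Bool :=
  (entry g c r || entry g d r) ||
    (anyVertex (fun x => entry g c x &&
        allVertex fun s => bif entry g r s then dominationTest g x d s else true) ||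
      anyVertex (fun x => entry g d x &&
        allVertex fun s => bif entry g r s then dominationTest g c x s else true))

/-- The pairs of starting vertices that the two cops try. -/
def starts : List (Fin 9 × Fin 9) := [(0, 5), (1, 4), (0, 2), (2, 6), (2, 7)]

/-- Two lazy cops win on the graph packed into `g` from one of the `starts`. -/
def startTest (g : ℕ) : Bool :=
  starts.any fun c => allVertex fun r => lazyTest g c.1 c.2 r

/-- `startTest` for the number encoding `l`.  Matching on a successor makes kernel reduction
evaluate the encoding once. -/
def matrixTest (l : List Bool) : Bool :=
  match encodeBits l + 1 with
  | 0 => false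
  | g + 1 => startTest g

/-- The reflexive adjacency matrix of the graph in which vertex `0` has neighbours `2, 3, 4`,
vertex `1` has neighbours `2, 3, 5`, and the adjacencies between `y, z, a, b, p, q, r = 2, …, 8`
are as prescribed. -/
def matrix (yz ya yb yp yq yr za zb zp zq zr ab ap aq ar bp bq br pq pr qr : Bool) : List Bool :=
  [true, false, true, true, true, false, false, false, false,
    false, true, true, true, false, true, false, false, false,
    true, true, true, yz, ya, yb, yp, yq, yr,
    true, true, yz, true, za, zb, zp, zq, zr,
    true, false, ya, za, true, ab, ap, aq, ar,
    false, true, yb, zb, ab, true, bp, bq, br,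
    false, false, yp, zp, ap, bp, true, pq, pr,
    false, false, yq, zq, aq, bq, pq, true, qr,
    false, false, yr, zr, ar, br, pr, qr, true]

theorem entry_eq_testBit (g : ℕ) (i j : Fin 9) : entry g i j = g.testBit (9 * i.1 + j.1) := by
  have h : Nat.land 1 (Nat.shiftRight g (9 * i.1 + j.1)) = g >>> (9 * i.1 + j.1) % 2 :=
    Nat.one_and_eq_mod_two _
  change (Nat.land 1 (Nat.shiftRight g (9 * i.1 + j.1))).beq 1 = _
  rw [h, Nat.testBit_eq_decide_div_mod_eq, Nat.shiftRight_eq_div_pow]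
  rcases Nat.mod_two_eq_zero_or_one (g / 2 ^ (9 * i.1 + j.1)) with h | h <;>
    rw [h] <;> rfl

theorem testBit_row (g : ℕ) (i j : Fin 9) : (row g i).testBit j.1 = entry g i j := by
  have h : row g i = (g >>> (9 * i.1)) % 2 ^ 9 := rfl
  rw [h, Nat.testBit_mod_two_pow, Nat.testBit_shiftRight, entry_eq_testBit]
  simp

theorem entry_of_covered {g : ℕ} {c d r : Fin 9} (h : covered g c d r = true) {s : Fin 9}
    (hs : entry g r s = true) : entry g c s = true ∨ entry g d s = true := by
  have h' : row g r = (row g c ||| row g d) &&& row g r := Nat.eq_of_beq_eq_true h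
  rw [← testBit_row, h', Nat.testBit_and, Nat.testBit_or, testBit_row, testBit_row,
    Bool.and_eq_true, Bool.or_eq_true] at hs
  exact hs.1

theorem exists_of_anyVertex {f : Fin 9 → Bool} (h : anyVertex f = true) : ∃ i, f i = true := by
  simp only [anyVertex, Bool.or_eq_true] at h
  rcases h with h | h | h | h | h | h | h | h | h <;> exact ⟨_, h⟩

theorem forall_of_allVertex {f : Fin 9 → Bool} (h : allVertex f = true) (i : Fin 9) :
    f i = true := by
  simp only [allVertex, Bool.and_eq_true] at h
  obtain ⟨h0, h1, h2, h3, h4, h5, h6, h7, h8⟩ := h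
  fin_cases i <;> assumption

section Soundness

variable {V : Type*} {G : SimpleGraph V} {v : Fin 9 → V} {g : ℕ}

theorem lazyWinFrom_of_entry (hg : ∀ i j, entry g i j = true ↔ v i = v j ∨ G.Adj (v i) (v j))
    {c d r : Fin 9} (h : (entry g c r || entry g d r) = true) :
    LazyWinFrom G ![v c, v d] (v r) := by
  rw [Bool.or_eq_true, hg, hg] at h
  exact lazyWinFrom_of_mem_closed_neighborhood h

theorem lazyWinFrom_of_forall_entry (hv : v.Surjective)
    (hg : ∀ i j, entry g i j = true ↔ v i = v j ∨ G.Adj (v i) (v j)) {c d x y r : Fin 9}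
    (hmove : entry g c x = true ∧ d = y ∨ entry g d y = true ∧ c = x)
    (h : ∀ s, entry g r s = true → LazyWinFrom G ![v x, v y] (v s)) :
    LazyWinFrom G ![v c, v d] (v r) := by
  have hnext : ∀ r', (r' = v r ∨ G.Adj (v r) r') → LazyWinFrom G ![v x, v y] r' := by
    intro r' hr'
    obtain ⟨s, rfl⟩ := hv r'
    exact h s ((hg r s).2 (hr'.imp_left Eq.symm))
  simp only [hg] at hmove
  rcases hmove with ⟨hm, rfl⟩ | ⟨hm, rfl⟩
  · exact .step ![v x, v d] 0 (by simpa [eq_comm] using hm) (by simp) hnext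
  · exact .step ![v c, v y] 1 (by simpa [eq_comm] using hm) (by simp) hnext

theorem lazyWinFrom_of_dominationTest (hv : v.Surjective)
    (hg : ∀ i j, entry g i j = true ↔ v i = v j ∨ G.Adj (v i) (v j)) {c d r : Fin 9}
    (h : dominationTest g c d r = true) : LazyWinFrom G ![v c, v d] (v r) := by
  have key : ∀ {x y s : Fin 9}, covered g x y r = true → entry g r s = true →
      LazyWinFrom G ![v x, v y] (v s) := fun hx hs =>
    lazyWinFrom_of_entry hg ((Bool.or_eq_true _ _).mpr (entry_of_covered hx hs))
  rw [dominationTest, Bool.or_eq_true, Bool.or_eq_true (anyVertex _)] at h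
  rcases h with h | h | h
  · exact lazyWinFrom_of_entry hg h
  all_goals
    obtain ⟨x, hx⟩ := exists_of_anyVertex h
    rw [Bool.and_eq_true] at hx
  · exact lazyWinFrom_of_forall_entry hv hg (.inl ⟨hx.1, rfl⟩) fun s hs => key hx.2 hs
  · exact lazyWinFrom_of_forall_entry hv hg (.inr ⟨hx.1, rfl⟩) fun s hs => key hx.2 hs

theorem lazyWinFrom_of_lazyTest (hv : v.Surjective)
    (hg : ∀ i j, entry g i j = true ↔ v i = v j ∨ G.Adj (v i) (v j)) {c d r : Fin 9}
    (h : lazyTest g c d r = true) : LazyWinFrom G ![v c, v d] (v r) := by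
  have key : ∀ {x y s : Fin 9}, (allVertex fun s =>
      bif entry g r s then dominationTest g x y s else true) = true → entry g r s = true →
      LazyWinFrom G ![v x, v y] (v s) := by
    intro x y s hx hs
    have := forall_of_allVertex hx s
    rw [hs] at this
    exact lazyWinFrom_of_dominationTest hv hg this
  rw [lazyTest, Bool.or_eq_true, Bool.or_eq_true (anyVertex _)] at h
  rcases h with h | h | h
  · exact lazyWinFrom_of_entry hg h
  all_goals
    obtain ⟨x, hx⟩ := exists_of_anyVertex h
    rw [Bool.and_eq_true] at hx
  · exact lazyWinFrom_of_forall_entry hv hg (.inl ⟨hx.1, rfl⟩) fun s hs => key hx.2 hs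
  · exact lazyWinFrom_of_forall_entry hv hg (.inr ⟨hx.1, rfl⟩) fun s hs => key hx.2 hs

theorem lazyCopsWin_of_startTest (hv : v.Surjective)
    (hg : ∀ i j, entry g i j = true ↔ v i = v j ∨ G.Adj (v i) (v j))
    (h : startTest g = true) : LazyCopsWin G 2 := by
  obtain ⟨c, -, hc⟩ := List.any_eq_true.1 h
  refine ⟨![v c.1, v c.2], fun r => ?_⟩
  obtain ⟨s, rfl⟩ := hv r
  exact lazyWinFrom_of_lazyTest hv hg (forall_of_allVertex hc s)

end Soundness

theorem lazyCopsWin_of_matrixTest {V : Type*} {G : SimpleGraph V} {v : Fin 9 → V}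
    (hv : v.Surjective) {l : List Bool}
    (hl : ∀ i j : Fin 9, l.getD (9 * i.1 + j.1) false = true ↔ v i = v j ∨ G.Adj (v i) (v j))
    (h : matrixTest l = true) : LazyCopsWin G 2 := by
  refine lazyCopsWin_of_startTest hv (g := encodeBits l) (fun i j => ?_) h
  rw [entry_eq_testBit, testBit_encodeBits, hl]

set_option synthInstance.maxSize 2000 in
set_option synthInstance.maxHeartbeats 400000 in
theorem matrixTest_matrix : ∀ yz ya yb yp yq yr : Bool,
    yz.toNat + ya.toNat + yb.toNat + yp.toNat + yq.toNat + yr.toNat ≤ 1 →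
    ∀ za zb zp zq zr : Bool,
    yz.toNat + za.toNat + zb.toNat + zp.toNat + zq.toNat + zr.toNat ≤ 1 →
    ∀ ab ap aq ar : Bool,
    1 ≤ ya.toNat + za.toNat + ab.toNat + ap.toNat + aq.toNat + ar.toNat →
    ya.toNat + za.toNat + ab.toNat + ap.toNat + aq.toNat + ar.toNat ≤ 2 →
    ∀ bp bq br : Bool,
    1 ≤ yb.toNat + zb.toNat + ab.toNat + bp.toNat + bq.toNat + br.toNat →
    yb.toNat + zb.toNat + ab.toNat + bp.toNat + bq.toNat + br.toNat ≤ 2 →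
    (yp || yq || yr || zp || zq || zr || ap || aq || ar || bp || bq || br) = true →
    8 * yq.toNat + 4 * zq.toNat + 2 * aq.toNat + bq.toNat ≤
      8 * yp.toNat + 4 * zp.toNat + 2 * ap.toNat + bp.toNat →
    8 * yr.toNat + 4 * zr.toNat + 2 * ar.toNat + br.toNat ≤
      8 * yq.toNat + 4 * zq.toNat + 2 * aq.toNat + bq.toNat →
    ∀ pq pr : Bool,
    2 ≤ yp.toNat + zp.toNat + ap.toNat + bp.toNat + pq.toNat + pr.toNat →
    yp.toNat + zp.toNat + ap.toNat + bp.toNat + pq.toNat + pr.toNat ≤ 3 →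
    ∀ qr : Bool,
    2 ≤ yq.toNat + zq.toNat + aq.toNat + bq.toNat + pq.toNat + qr.toNat →
    yq.toNat + zq.toNat + aq.toNat + bq.toNat + pq.toNat + qr.toNat ≤ 3 →
    2 ≤ yr.toNat + zr.toNat + ar.toNat + br.toNat + pr.toNat + qr.toNat →
    yr.toNat + zr.toNat + ar.toNat + br.toNat + pr.toNat + qr.toNat ≤ 3 →
    matrixTest (matrix yz ya yb yp yq yr za zb zp zq zr ab ap aq ar bp bq br pq pr qr) = true := by
  decide +kernel

theorem exists_sorted_triple {α : Type*} [DecidableEq α] (f : α → ℕ) {S : Finset α}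
    (hS : S.card = 3) :
    ∃ p q r, p ≠ q ∧ p ≠ r ∧ q ≠ r ∧ S = {p, q, r} ∧ f q ≤ f p ∧ f r ≤ f q := by
  obtain ⟨p, q, r, hpq, hpr, hqr, rfl⟩ := Finset.card_eq_three.1 hS
  rcases le_total (f p) (f q) with h₁ | h₁ <;> rcases le_total (f p) (f r) with h₂ | h₂ <;>
    rcases le_total (f q) (f r) with h₃ | h₃
  · exact ⟨r, q, p, hqr.symm, hpr.symm, hpq.symm, by grind, h₃, h₁⟩
  · exact ⟨q, r, p, hqr, hpq.symm, hpr.symm, by grind, h₃, h₂⟩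
  · exact ⟨q, p, r, hpq.symm, hqr, hpr, by grind, h₁, h₂⟩
  · exact ⟨q, p, r, hpq.symm, hqr, hpr, by grind, h₁, h₂⟩
  · exact ⟨r, p, q, hpr.symm, hqr.symm, hpq, by grind, h₂, h₁⟩
  · exact ⟨p, r, q, hpr, hpq, hqr.symm, by grind, by grind, by grind⟩
  · exact ⟨p, r, q, hpr, hpq, hqr.symm, by grind, h₂, h₃⟩
  · exact ⟨p, q, r, hpq, hpr, hqr, by grind, h₁, h₃⟩

/-- A vertex of degree three with two distinct prescribed neighbours has exactly one more. -/
theorem exists_third_neighbor {V : Type*} [Fintype V] [DecidableEq V] {G : SimpleGraph V}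
    [DecidableRel G.Adj] {u y z : V} (hu : G.degree u = 3) (hyz : y ≠ z) (hy : G.Adj u y)
    (hz : G.Adj u z) : ∃ a, a ≠ y ∧ a ≠ z ∧ ∀ x, G.Adj u x ↔ x = y ∨ x = z ∨ x = a := by
  have hsub : ({y, z} : Finset V) ⊆ G.neighborFinset u := by
    intro x hx
    simp only [Finset.mem_insert, Finset.mem_singleton] at hx
    rcases hx with rfl | rfl <;> simpa
  have hc : (G.neighborFinset u \ {y, z}).card = 1 := by
    rw [Finset.card_sdiff_of_subset hsub, Finset.card_pair hyz, G.card_neighborFinset_eq_degree, hu]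
  obtain ⟨a, ha⟩ := Finset.card_eq_one.1 hc
  have hmem : ∀ x, (G.Adj u x ∧ ¬(x = y ∨ x = z)) ↔ x = a := fun x => by
    simpa using Finset.ext_iff.1 ha x
  have haa := (hmem a).2 rfl
  refine ⟨a, fun h => haa.2 (.inl h), fun h => haa.2 (.inr h), fun x => ⟨fun hx => ?_, ?_⟩⟩
  · have := hmem x
    tauto
  · rintro (rfl | rfl | rfl)
    exacts [hy, hz, haa.1]

/-- In a connected graph, some edge leaves any set that is neither empty nor everything. -/
theorem exists_adj_of_connected {V : Type*} {G : SimpleGraph V} (hG : G.Connected) {S : Set V}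
    {x y : V} (hx : x ∈ S) (hy : y ∉ S) : ∃ a ∈ S, ∃ b ∉ S, G.Adj a b := by
  obtain ⟨w⟩ := hG.preconnected x y
  obtain ⟨d, -, h₁, h₂⟩ := w.exists_boundary_dart S hx hy
  exact ⟨d.fst, h₁, d.snd, h₂, d.adj⟩

theorem sum_toNat_adj_eq_degree {V ι : Type*} [Fintype V] [Fintype ι] {G : SimpleGraph V}
    [DecidableRel G.Adj] {v : ι → V} (hv : v.Bijective) (x : V) :
    ∑ j, (decide (G.Adj x (v j))).toNat = G.degree x := by
  rw [hv.sum_comp (fun w => (decide (G.Adj x w)).toNat), ← G.card_neighborFinset_eq_degree,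
    G.neighborFinset_eq_filter, Finset.card_filter]
  refine Finset.sum_congr rfl fun w _ => ?_
  by_cases h : G.Adj x w <;> simp [h]

/-- 9 vertices, `2 ≤ δ(G) ≤ Δ(G) ≤ 3`, and two (nonadjacent)
degree-3 vertices with exactly two common neighbors `y, z` imply
`c_L(G) ≤ 2`. -/
theorem lazy_le_two_of_two_common_neighbors_nonadjacent
    {V : Type*} [Fintype V] [Nonempty V] (G : SimpleGraph V)
    [DecidableRel G.Adj] (hconn : G.Connected)
    (hcard : Fintype.card V = 9)
    (hδ : 2 ≤ G.minDegree) (hΔ : G.maxDegree ≤ 3)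
    (u₁ u₂ : V) (h1 : G.degree u₁ = 3) (h2 : G.degree u₂ = 3)
    (y z : V) (hyz : y ≠ z)
    (hy1 : y ≠ u₁) (hy2 : y ≠ u₂) (hz1 : z ≠ u₁) (hz2 : z ≠ u₂)
    (hN : insert u₁ (G.neighborSet u₁) ∩ insert u₂ (G.neighborSet u₂) =
      {y, z}) :
    lazyCopNumber G ≤ 2 := by
  classical
  have hiff : ∀ x, ((x = u₁ ∨ G.Adj u₁ x) ∧ (x = u₂ ∨ G.Adj u₂ x)) ↔ x = y ∨ x = z := fun x => by
    simpa using Set.ext_iff.1 hN x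
  have hy := (hiff y).2 (.inl rfl)
  have hz := (hiff z).2 (.inr rfl)
  have h1y : G.Adj u₁ y := hy.1.resolve_left hy1
  have h2y : G.Adj u₂ y := hy.2.resolve_left hy2
  have h1z : G.Adj u₁ z := hz.1.resolve_left hz1
  have h2z : G.Adj u₂ z := hz.2.resolve_left hz2
  have hu : u₁ ≠ u₂ := by
    rintro rfl
    obtain ⟨a, hay, haz, ha⟩ := exists_third_neighbor h1 hyz h1y h1z
    have := (hiff a).1 ⟨.inr ((ha a).2 (by simp)), .inr ((ha a).2 (by simp))⟩
    tauto
  have hnadj : ¬G.Adj u₁ u₂ := by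
    intro h
    rcases (hiff u₂).1 ⟨.inr h, .inl rfl⟩ with h | h
    exacts [hy2 h.symm, hz2 h.symm]
  obtain ⟨a, hay, haz, ha⟩ := exists_third_neighbor h1 hyz h1y h1z
  obtain ⟨b, hby, hbz, hb⟩ := exists_third_neighbor h2 hyz h2y h2z
  have h1a : G.Adj u₁ a := (ha a).2 (by simp)
  have h2b : G.Adj u₂ b := (hb b).2 (by simp)
  have hab : a ≠ b := by
    rintro rfl
    have := (hiff a).1 ⟨.inr h1a, .inr h2b⟩
    tauto
  have ha2 : a ≠ u₂ := fun h => hnadj (h ▸ h1a)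
  have hb1 : b ≠ u₁ := fun h => hnadj (h ▸ h2b).symm
  have ha1 := h1a.ne'
  have hb2 := h2b.ne'
  have hS : ({u₁, u₂, y, z, a, b} : Finset V)ᶜ.card = 3 := by
    rw [Finset.card_compl, hcard]
    have : ({u₁, u₂, y, z, a, b} : Finset V).card = 6 := by
      repeat rw [Finset.card_insert_of_notMem (by simp; tauto)]
      simp
    omega
  set B : V → V → Bool := fun x w => decide (G.Adj x w) with hB
  obtain ⟨p, q, r, hpq, hpr, hqr, hS', hkey₁, hkey₂⟩ := exists_sorted_triple
    (fun x => 8 * (B y x).toNat + 4 * (B z x).toNat + 2 * (B a x).toNat + (B b x).toNat) hS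
  have hmem : ∀ x, ¬(x = u₁ ∨ x = u₂ ∨ x = y ∨ x = z ∨ x = a ∨ x = b) ↔
      x = p ∨ x = q ∨ x = r := fun x => by
    simpa using Finset.ext_iff.1 hS' x
  have hp := (hmem p).2 (by simp)
  have hq := (hmem q).2 (by simp)
  have hr := (hmem r).2 (by simp)
  let v : Fin 9 → V := ![u₁, u₂, y, z, a, b, p, q, r]
  have hsurj : v.Surjective := by
    intro x
    by_cases hx : x = u₁ ∨ x = u₂ ∨ x = y ∨ x = z ∨ x = a ∨ x = b
    · rcases hx with rfl | rfl | rfl | rfl | rfl | rfl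
      exacts [⟨0, rfl⟩, ⟨1, rfl⟩, ⟨2, rfl⟩, ⟨3, rfl⟩, ⟨4, rfl⟩, ⟨5, rfl⟩]
    · rcases (hmem x).1 hx with rfl | rfl | rfl
      exacts [⟨6, rfl⟩, ⟨7, rfl⟩, ⟨8, rfl⟩]
  have hbij : v.Bijective :=
    (Fintype.bijective_iff_surjective_and_card v).2 ⟨hsurj, by simp [hcard]⟩
  have hsymm : ∀ x w, B x w = B w x := fun x w => by simp [hB, G.adj_comm]
  have hself : ∀ x, B x x = false := fun x => by simp [hB]
  have hB1 : ∀ x, B u₁ x = decide (x = y ∨ x = z ∨ x = a) := fun x => by simp [hB, ha]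
  have hB2 : ∀ x, B u₂ x = decide (x = y ∨ x = z ∨ x = b) := fun x => by simp [hB, hb]
  have hdeg : ∀ x, 2 ≤ ∑ j, (B x (v j)).toNat ∧ ∑ j, (B x (v j)).toNat ≤ 3 := fun x => by
    rw [hB, sum_toNat_adj_eq_degree hbij x]
    exact ⟨hδ.trans (G.minDegree_le_degree x), (G.degree_le_maxDegree x).trans hΔ⟩
  push Not at hp hq hr
  have hrow1 : B u₁ u₂ = false ∧ B u₁ y = true ∧ B u₁ z = true ∧ B u₁ a = true ∧ B u₁ b = false ∧
      B u₁ p = false ∧ B u₁ q = false ∧ B u₁ r = false := by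
    simp only [hB1, decide_eq_true_eq, decide_eq_false_iff_not]
    grind
  have hrow2 : B u₂ u₁ = false ∧ B u₂ y = true ∧ B u₂ z = true ∧ B u₂ a = false ∧ B u₂ b = true ∧
      B u₂ p = false ∧ B u₂ q = false ∧ B u₂ r = false := by
    simp only [hB2, decide_eq_true_eq, decide_eq_false_iff_not]
    grind
  clear_value B
  have hsplit : ∀ x, (B x u₁).toNat + (B x u₂).toNat + (B x y).toNat + (B x z).toNat +
      (B x a).toNat + (B x b).toNat + (B x p).toNat + (B x q).toNat + (B x r).toNat =
        ∑ j, (B x (v j)).toNat := fun x => by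
    rw [Fin.sum_univ_castSucc, Fin.sum_univ_eight]
    rfl
  simp only [← hsplit] at hdeg
  have hout : (B y p || B y q || B y r || B z p || B z q || B z r || B a p || B a q || B a r ||
      B b p || B b q || B b r) = true := by
    obtain ⟨x, hx, w, hw, hxw⟩ := exists_adj_of_connected hconn
      (S := {x | x = u₁ ∨ x = u₂ ∨ x = y ∨ x = z ∨ x = a ∨ x = b})
      (.inl rfl) ((hmem p).2 (.inl rfl))
    have hBxw : B x w = true := by simpa [hB] using hxw
    rcases (hmem w).1 hw with h | h | h <;> rcases hx with h' | h' | h' | h' | h' | h' <;>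
      rw [h, h'] at hBxw <;> first | (simp [hBxw]; done) | simp [hrow1, hrow2] at hBxw
  have hdy := hdeg y
  have hdz := hdeg z
  have hda := hdeg a
  have hdb := hdeg b
  have hdp := hdeg p
  have hdq := hdeg q
  have hdr := hdeg r
  simp only [hsymm y u₁, hsymm y u₂, hsymm z u₁, hsymm z u₂, hsymm z y, hsymm a u₁, hsymm a u₂,
    hsymm a y, hsymm a z, hsymm b u₁, hsymm b u₂, hsymm b y, hsymm b z, hsymm b a,
    hsymm p u₁, hsymm p u₂, hsymm p y, hsymm p z, hsymm p a, hsymm p b, hsymm q u₁,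
    hsymm q u₂, hsymm q y, hsymm q z, hsymm q a, hsymm q b, hsymm q p, hsymm r u₁,
    hsymm r u₂, hsymm r y, hsymm r z, hsymm r a, hsymm r b, hsymm r p, hsymm r q, hrow1,
    hrow2, hself, Bool.toNat_true, Bool.toNat_false]
    at hdy hdz hda hdb hdp hdq hdr
  have hentry : ∀ i j : Fin 9, (matrix (B y z) (B y a) (B y b) (B y p) (B y q) (B y r) (B z a)
      (B z b) (B z p) (B z q) (B z r) (B a b) (B a p) (B a q)
      (B a r) (B b p) (B b q) (B b r) (B p q) (B p r) (B q r)).getD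
      (9 * i.1 + j.1) false = (decide (i = j) || B (v i) (v j)) := by
    intro i j
    fin_cases i <;> fin_cases j <;> simp [matrix, v, hrow1, hrow2, hself, hsymm]
  refine Nat.sInf_le (lazyCopsWin_of_matrixTest hsurj
    (fun i j => (Bool.eq_iff_iff.1 (hentry i j)).trans ?_)
    (matrixTest_matrix _ _ _ _ _ _ ?_ _ _ _ _ _ ?_ _ _ _ _ ?_ ?_ _ _ _ ?_ ?_ hout hkey₁ hkey₂
      _ _ ?_ ?_ _ ?_ ?_ ?_ ?_))
  · rw [hbij.1.eq_iff]
    simp [hB]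
  · clear hkey₁ hkey₂ hdz hda hdb hdp hdq hdr
    omega
  · clear hkey₁ hkey₂ hdy hda hdb hdp hdq hdr
    omega
  · clear hkey₁ hkey₂ hdy hdz hdb hdp hdq hdr
    omega
  · clear hkey₁ hkey₂ hdy hdz hdb hdp hdq hdr
    omega
  · clear hkey₁ hkey₂ hdy hdz hda hdp hdq hdr
    omega
  · clear hkey₁ hkey₂ hdy hdz hda hdp hdq hdr
    omega
  · clear hkey₁ hkey₂ hdy hdz hda hdb hdq hdr
    omega
  · clear hkey₁ hkey₂ hdy hdz hda hdb hdq hdr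
    omega
  · clear hkey₁ hkey₂ hdy hdz hda hdb hdp hdr
    omega
  · clear hkey₁ hkey₂ hdy hdz hda hdb hdp hdr
    omega
  · clear hkey₁ hkey₂ hdy hdz hda hdb hdp hdq
    omega
  · clear hkey₁ hkey₂ hdy hdz hda hdb hdp hdq
    omega

end CopsRobbers
end

section
/- Let G be a finite connected simple graph on 9 vertices with 2 ≤ δ(G) ≤ Δ(G) ≤ 3. If there exist vertices u₁, u₂, both of degree 3, with |N(u₁) ∩ N(u₂)| = 3 (i.e., u₁ and u₂ have all three of their neighbors in common), then c_L(G) ≤ 2. -/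
/-!
Cops and robbers on a simple graph `G`.

A *configuration* consists of the positions of the `k` cops (a function
`Fin k → V`) together with the robber's position, with the cops to move.
The cops win if at some point a cop occupies the robber's vertex.
-/

namespace CopsRobbers

variable {V : Type*}

/-- A robber adjacent to cop `j` is caught. -/
theorem LazyWinFrom.of_adj {G : SimpleGraph V} {k : ℕ} {c : Fin k → V} {r : V} (j : Fin k)
    (h : G.Adj (c j) r) : LazyWinFrom G c r :=
  .stepCatch (Function.update c j r) j (by simp [h])
    (fun i hi => Function.update_of_ne hi _ _) j (by simp)

/-- If cop `i` is adjacent to every neighbor of the robber, the robber is trapped, and another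
cop `j` can walk up to him. -/
theorem LazyWinFrom.of_trapped {G : SimpleGraph V} (hconn : G.Connected) {k : ℕ}
    {c : Fin k → V} {r : V} {i j : Fin k} (hij : i ≠ j)
    (hguard : ∀ x, G.Adj r x → G.Adj (c i) x) : LazyWinFrom G c r := by
  obtain ⟨p⟩ := hconn.preconnected (c j) r
  generalize hv : c j = v at p
  induction p generalizing c with
  | nil => exact .caught j hv
  | @cons _ w _ hadj _ ih =>
    have hi : Function.update c j w i = c i := Function.update_of_ne hij _ _
    refine .step (Function.update c j w) j (by simp [hv, hadj])
      (fun l hl => Function.update_of_ne hl _ _) ?_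
    rintro r' (rfl | hr')
    · exact ih (by rwa [hi]) (by simp)
    · exact .of_adj i (by rw [hi]; exact hguard r' hr')

/-- If cop `j` can move to a neighbor `s` of the robber, and cop `i` guards all his other
neighbors, then the robber is caught. -/
theorem LazyWinFrom.of_approach {G : SimpleGraph V} {k : ℕ} {c : Fin k → V} {r s : V}
    {i j : Fin k} (hij : i ≠ j) (hjs : G.Adj (c j) s) (hsr : G.Adj s r)
    (hguard : ∀ x, G.Adj r x → x = s ∨ G.Adj (c i) x) : LazyWinFrom G c r := by
  refine .step (Function.update c j s) j (by simp [hjs])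
    (fun l hl => Function.update_of_ne hl _ _) ?_
  rintro r' (rfl | hr')
  · exact .of_adj j (by simpa using hsr)
  · obtain rfl | h := hguard r' hr'
    · exact .caught j (by simp)
    · exact .of_adj i (by rwa [Function.update_of_ne hij])

/-- Suppose the maximum degree is at most three and every neighbor of `u₁` is also a neighbor
of `u₂`. Then any set of more than `G.degree u₁` further vertices contains one that has no
neighbor in common with `u₁`. -/
theorem exists_no_common_neighbor [Fintype V] {G : SimpleGraph V} [DecidableRel G.Adj]
    {u₁ u₂ : V} (hne : u₁ ≠ u₂) (hΔ : G.maxDegree ≤ 3)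
    (hsub : ∀ x, G.Adj u₁ x → G.Adj u₂ x) {W : Finset V} (hcard : G.degree u₁ < W.card)
    (hW₁ : u₁ ∉ W) (hW₂ : u₂ ∉ W) :
    ∃ w ∈ W, ∀ x, G.Adj w x → ¬ G.Adj u₁ x := by
  classical
  by_contra! hcon
  choose! f hf hfu using hcon
  obtain ⟨v, hv, w, hw, hvw, hfvw⟩ := Finset.exists_ne_map_eq_of_card_lt_of_maps_to
    (s := W) (t := G.neighborFinset u₁) (by simpa using hcard) (f := f)
    (fun w hw => by simpa using hfu w hw)
  have hle : ({u₁, u₂, v, w} : Finset V) ⊆ G.neighborFinset (f v) := by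
    intro y hy
    simp only [Finset.mem_insert, Finset.mem_singleton] at hy
    rw [SimpleGraph.mem_neighborFinset]
    rcases hy with rfl | rfl | rfl | rfl
    · exact (hfu v hv).symm
    · exact (hsub _ (hfu v hv)).symm
    · exact (hf _ hv).symm
    · rw [hfvw]; exact (hf _ hw).symm
  have h4 : ({u₁, u₂, v, w} : Finset V).card = 4 := by
    have h1v : u₁ ≠ v := by rintro rfl; exact hW₁ hv
    have h1w : u₁ ≠ w := by rintro rfl; exact hW₁ hw
    have h2v : u₂ ≠ v := by rintro rfl; exact hW₂ hv
    have h2w : u₂ ≠ w := by rintro rfl; exact hW₂ hw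
    simp [*]
  have := Finset.card_le_card hle
  rw [SimpleGraph.card_neighborFinset_eq_degree] at this
  have := G.degree_le_maxDegree (f v)
  omega

/-- 9 vertices, `2 ≤ δ(G) ≤ Δ(G) ≤ 3`, and two degree-3
vertices with all three neighbors in common imply `c_L(G) ≤ 2`. -/
theorem lazy_le_two_of_three_common_neighbors
    {V : Type*} [Fintype V] [Nonempty V] (G : SimpleGraph V)
    [DecidableRel G.Adj] (hconn : G.Connected)
    (hcard : Fintype.card V = 9)
    (hδ : 2 ≤ G.minDegree) (hΔ : G.maxDegree ≤ 3)
    (u₁ u₂ : V) (hne : u₁ ≠ u₂)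
    (h1 : G.degree u₁ = 3) (h2 : G.degree u₂ = 3)
    (hN : (G.neighborSet u₁ ∩ G.neighborSet u₂).ncard = 3) :
    lazyCopNumber G ≤ 2 := by
  classical
  have hN₁ : G.neighborSet u₁ ∩ G.neighborSet u₂ = G.neighborSet u₁ :=
    Set.eq_of_subset_of_ncard_le Set.inter_subset_left
      (by rw [hN, Set.ncard_eq_toFinset_card', ← SimpleGraph.neighborFinset_def,
        SimpleGraph.card_neighborFinset_eq_degree, h1])
  have hN₂ : G.neighborSet u₁ ∩ G.neighborSet u₂ = G.neighborSet u₂ :=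
    Set.eq_of_subset_of_ncard_le Set.inter_subset_right
      (by rw [hN, Set.ncard_eq_toFinset_card', ← SimpleGraph.neighborFinset_def,
        SimpleGraph.card_neighborFinset_eq_degree, h2])
  have hiff (x : V) : G.Adj u₁ x ↔ G.Adj u₂ x := Set.ext_iff.1 (hN₁.symm.trans hN₂) x
  have hu : ¬ G.Adj u₁ u₂ := fun h => G.irrefl ((hiff u₂).1 h)
  set W : Finset V := Finset.univ \ ({u₁, u₂} ∪ G.neighborFinset u₁) with hWdef
  have hmem (x : V) : x ∈ W ↔ x ≠ u₁ ∧ x ≠ u₂ ∧ ¬ G.Adj u₁ x := by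
    simp [hWdef]
  have hWcard : W.card = 4 := by
    rw [hWdef, Finset.card_sdiff_of_subset (Finset.subset_univ _), Finset.card_univ, hcard,
      Finset.card_union_of_disjoint, SimpleGraph.card_neighborFinset_eq_degree, h1,
      Finset.card_pair hne]
    simp [hu]
  -- With a cop on `u₁`, only the vertices of `W` not adjacent to the other cop matter.
  suffices hmain : ∃ w, ∀ r ∈ W, r ≠ w → ¬ G.Adj w r → LazyWinFrom G ![u₁, w] r by
    obtain ⟨w, hw⟩ := hmain
    refine Nat.sInf_le ⟨![u₁, w], fun r => ?_⟩
    by_cases hr₁ : r = u₁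
    · exact .caught 0 hr₁.symm
    by_cases hr₂ : r = u₂
    · subst hr₂
      exact .of_trapped hconn (i := 0) (j := 1) (by decide) fun x hx => (hiff x).2 hx
    by_cases hr : G.Adj u₁ r
    · exact .of_adj 0 hr
    by_cases hrw : r = w
    · exact .caught 1 hrw.symm
    by_cases hwr : G.Adj w r
    · exact .of_adj 1 hwr
    exact hw r ((hmem r).2 ⟨hr₁, hr₂, hr⟩) hrw hwr
  obtain ⟨w, hw, hwN⟩ := exists_no_common_neighbor hne hΔ (fun x => (hiff x).1)
    (W := W) (by omega) (by simp [hmem]) (by simp [hmem])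
  have hWadj {v x : V} (hv : v ∈ W) (hvx : G.Adj v x) : x ∈ W ∨ G.Adj u₁ x := by
    by_cases hx : G.Adj u₁ x
    · exact .inr hx
    refine .inl ((hmem x).2 ⟨?_, ?_, hx⟩)
    · rintro rfl
      exact ((hmem v).1 hv).2.2 hvx.symm
    · rintro rfl
      exact ((hmem v).1 hv).2.2 ((hiff v).2 hvx.symm)
  by_cases hdom : ∀ r ∈ W, r ≠ w → G.Adj w r
  · exact ⟨w, fun r hr hrw hwr => (hwr (hdom r hr hrw)).elim⟩
  push Not at hdom
  obtain ⟨z, hz, hzw, hwz⟩ := hdom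
  have hNw : G.neighborFinset w = (W.erase w).erase z := by
    refine Finset.eq_of_subset_of_card_le (fun x hx => ?_) ?_
    · rw [SimpleGraph.mem_neighborFinset] at hx
      simp only [Finset.mem_erase]
      refine ⟨?_, hx.ne', (hWadj hw hx).resolve_right (hwN x hx)⟩
      rintro rfl
      exact hwz hx
    · rw [Finset.card_erase_of_mem (by simp [hz, hzw]), Finset.card_erase_of_mem hw, hWcard,
        SimpleGraph.card_neighborFinset_eq_degree]
      exact hδ.trans (G.minDegree_le_degree w)
  have hadj (x : V) : G.Adj w x ↔ x ≠ z ∧ x ≠ w ∧ x ∈ W := by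
    simpa using Finset.ext_iff.1 hNw x
  by_cases hzN : ∀ x, G.Adj w x → G.Adj z x
  · -- The second cop starts on `z`, and `w` is the only vertex of `W` he does not dominate.
    refine ⟨z, fun r hr hrz hzr => ?_⟩
    obtain rfl : r = w := by
      by_contra hrw
      exact hzr (hzN r ((hadj r).2 ⟨hrz, hrw, hr⟩))
    exact .of_trapped hconn (i := 1) (j := 0) (by decide) hzN
  · -- The second cop starts on `w`, and `z` is the only vertex of `W` he does not dominate.
    push Not at hzN
    obtain ⟨x, hwx, hzx⟩ := hzN
    refine ⟨w, fun r hr hrw hwr => ?_⟩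
    obtain rfl : r = z := by
      by_contra hrz
      exact hwr ((hadj r).2 ⟨hrz, hrw, hr⟩)
    have hcardx : ((W.erase w).erase r).card = 2 := by
      rw [Finset.card_erase_of_mem (by simp [hr, hrw]), Finset.card_erase_of_mem hw, hWcard]
    have hcardy : (((W.erase w).erase r).erase x).card = 1 := by
      rw [Finset.card_erase_of_mem (by rw [← hNw]; simpa using hwx), hcardx]
    obtain ⟨y, hy⟩ := Finset.card_eq_one.1 hcardy
    have hWy {v : V} (hv : v ∈ W) (hvr : G.Adj r v) : v = y := by
      have : v ∈ ((W.erase w).erase r).erase x := by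
        simp only [Finset.mem_erase]
        refine ⟨?_, hvr.ne', ?_, hv⟩
        · rintro rfl
          exact hzx hvr
        · rintro rfl
          exact hwr hvr.symm
      simpa [hy] using this
    have hwy : G.Adj w y := by
      have : y ∈ ((W.erase w).erase r).erase x := by simp [hy]
      rw [← hNw] at this
      simpa using Finset.mem_of_mem_erase this
    by_cases hry : G.Adj r y
    · exact .of_approach (i := 0) (j := 1) (by decide) hwy hry.symm
        fun v hv => (hWadj hr hv).imp_left (hWy · hv)
    · refine .of_trapped hconn (i := 0) (j := 1) (by decide) fun v hv =>
        (hWadj hr hv).resolve_left fun hvW => hry ?_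
      rwa [← hWy hvW hv]

end CopsRobbers
end

section
/- Let G be a finite connected simple graph on 9 vertices with 2 ≤ δ(G) ≤ Δ(G) ≤ 3. If there exist adjacent vertices u₁, u₂, both of degree 3, and distinct vertices y, z, both different from u₁ and u₂, such that N̄(u₁) ∩ N̄(u₂) = {u₁, u₂, y, z} (i.e., u₁ and u₂ are adjacent and have exactly two common neighbors), then c_L(G) ≤ 2. -/
/-!
Cops and robbers on a simple graph `G`.

A *configuration* consists of the positions of the `k` cops (a function
`Fin k → V`) together with the robber's position, with the cops to move.
The cops win if at some point a cop occupies the robber's vertex.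
-/

namespace CopsRobbers

variable {V : Type*}

/-- The entry in row `i` and column `j` of a Boolean matrix given by its list of rows. -/
def boolEntry (A : List (List Bool)) (i j : ℕ) : Bool := (A.getD i []).getD j false

/-- A depth-bounded search for a win of two lazy cops at `c`, `d` against a robber at `r`, with
the cops to move, on the 9-vertex graph with reflexive adjacency matrix `A`; the bound `n` counts
the moves before the capturing one. -/
def searchWin (A : List (List Bool)) : ℕ → ℕ → ℕ → ℕ → Bool
  | 0, c, d, r => boolEntry A c r || boolEntry A d r
  | n + 1, c, d, r => boolEntry A c r || boolEntry A d r ||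
      (List.range 9).any fun x =>
        (boolEntry A c x &&
          (List.range 9).all fun r' => !boolEntry A r r' || searchWin A n x d r') ||
        (boolEntry A d x &&
          (List.range 9).all fun r' => !boolEntry A r r' || searchWin A n c x r')

/-- Two lazy cops win the bounded search from one of a few starting positions. -/
def searchStart (A : List (List Bool)) : Bool :=
  [(2, 5), (2, 8), (2, 7), (2, 6), (2, 4)].any fun p =>
    (List.range 9).all fun r => searchWin A 2 p.1 p.2 r

/-- The reflexive adjacency matrix of the graph on `{0, …, 8}` in which `0, 1, 2, 3` span a
diamond with nonadjacent pair `2, 3`, vertex `2` has `4` as its only other neighbor, the other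
neighbors of `3` are among `4, 5`, and the remaining adjacencies are given by the arguments. -/
def diamondMatrix (z4 z5 e45 e46 e47 e48 e56 e57 e58 e67 e68 e78 : Bool) : List (List Bool) :=
  [[true, true, true, true, false, false, false, false, false],
   [true, true, true, true, false, false, false, false, false],
   [true, true, true, false, true, false, false, false, false],
   [true, true, false, true, z4, z5, false, false, false],
   [false, false, true, z4, true, e45, e46, e47, e48],
   [false, false, false, z5, e45, true, e56, e57, e58],
   [false, false, false, false, e46, e56, true, e67, e68],
   [false, false, false, false, e47, e57, e67, true, e78],
   [false, false, false, false, e48, e58, e68, e78, true]]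

theorem searchStart_diamondMatrix :
    ∀ z4 z5 e45 e46 e47 e48 e56 e57 e58 e67 e68 e78 : Bool,
      (z5 || e45 || e46 || e47 || e48) = true →
      (e46 || e47 || e48 || e56 || e57 || e58) = true →
      ((diamondMatrix z4 z5 e45 e46 e47 e48 e56 e57 e58 e67 e68 e78).all fun l =>
        decide (3 ≤ l.count true) && decide (l.count true ≤ 4)) = true →
      searchStart (diamondMatrix z4 z5 e45 e46 e47 e48 e56 e57 e58 e67 e68 e78) = true := by
  decide +kernel

section

variable {G : SimpleGraph V}

theorem lazyWinFrom_of_searchWin {A : List (List Bool)} {f : ℕ → V}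
    (hA : ∀ i < 9, ∀ j < 9, (boolEntry A i j = true ↔ f i = f j ∨ G.Adj (f i) (f j)))
    (hf : ∀ v, ∃ i < 9, f i = v) {n c d r : ℕ} (hc : c < 9) (hd : d < 9) (hr : r < 9)
    (h : searchWin A n c d r = true) : LazyWinFrom G ![f c, f d] (f r) := by
  have move_left : ∀ {c x d : ℕ}, c < 9 → x < 9 → boolEntry A c x = true →
      (![f x, f d] 0 = ![f c, f d] 0 ∨ G.Adj (![f c, f d] 0) (![f x, f d] 0)) ∧
        ∀ i : Fin 2, i ≠ 0 → ![f x, f d] i = ![f c, f d] i := by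
    intro c x d hc hx h
    refine ⟨((hA c hc x hx).1 h).imp_left Eq.symm, ?_⟩
    intro i hi
    fin_cases i <;> simp_all
  have move_right : ∀ {c x d : ℕ}, d < 9 → x < 9 → boolEntry A d x = true →
      (![f c, f x] 1 = ![f c, f d] 1 ∨ G.Adj (![f c, f d] 1) (![f c, f x] 1)) ∧
        ∀ i : Fin 2, i ≠ 1 → ![f c, f x] i = ![f c, f d] i := by
    intro c x d hd hx h
    refine ⟨((hA d hd x hx).1 h).imp_left Eq.symm, ?_⟩
    intro i hi
    fin_cases i <;> simp_all
  have catch_now : ∀ {c d r : ℕ}, c < 9 → d < 9 → r < 9 →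
      (boolEntry A c r = true ∨ boolEntry A d r = true) → LazyWinFrom G ![f c, f d] (f r) := by
    rintro c d r hc hd hr (h | h)
    · obtain ⟨hm, hfix⟩ := move_left (d := d) hc hr h
      exact .stepCatch _ 0 hm hfix 0 rfl
    · obtain ⟨hm, hfix⟩ := move_right (c := c) hd hr h
      exact .stepCatch _ 1 hm hfix 1 rfl
  have reply : ∀ {r : ℕ} {P : V → Prop}, r < 9 →
      (∀ r' < 9, boolEntry A r r' = true → P (f r')) →
      ∀ v, v = f r ∨ G.Adj (f r) v → P v := by
    intro r P hr h v hv
    obtain ⟨i, hi, rfl⟩ := hf v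
    exact h i hi ((hA r hr i hi).2 (hv.imp_left Eq.symm))
  induction n generalizing c d r with
  | zero => exact catch_now hc hd hr (by simpa [searchWin] using h)
  | succ n ih =>
    simp only [searchWin, Bool.or_eq_true, List.any_eq_true, List.mem_range, Bool.and_eq_true,
      List.all_eq_true, Bool.not_eq_true'] at h
    obtain h | ⟨x, hx, ⟨hcx, h⟩ | ⟨hdx, h⟩⟩ := h
    · exact catch_now hc hd hr h
    · obtain ⟨hm, hfix⟩ := move_left (d := d) hc hx hcx
      refine .step _ 0 hm hfix (reply hr fun r' hr' hrr' => ih hx hd hr' ?_)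
      simpa [hrr'] using h r' hr'
    · obtain ⟨hm, hfix⟩ := move_right (c := c) hd hx hdx
      refine .step _ 1 hm hfix (reply hr fun r' hr' hrr' => ih hc hx hr' ?_)
      simpa [hrr'] using h r' hr'

theorem lazyCopsWin_of_searchStart {A : List (List Bool)} {f : ℕ → V}
    (hA : ∀ i < 9, ∀ j < 9, (boolEntry A i j = true ↔ f i = f j ∨ G.Adj (f i) (f j)))
    (hf : ∀ v, ∃ i < 9, f i = v) (h : searchStart A = true) : LazyCopsWin G 2 := by
  have key : ∃ c < 9, ∃ d < 9, ∀ r < 9, searchWin A 2 c d r = true := by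
    simp only [searchStart, List.any_cons, List.any_nil, Bool.or_eq_true, List.all_eq_true,
      List.mem_range, Bool.false_eq_true, or_false] at h
    obtain h | h | h | h | h := h <;> exact ⟨_, by norm_num, _, by norm_num, h⟩
  obtain ⟨c, hc, d, hd, h⟩ := key
  refine ⟨![f c, f d], fun v => ?_⟩
  obtain ⟨r, hr, rfl⟩ := hf v
  exact lazyWinFrom_of_searchWin hA hf hc hd hr (h r hr)

theorem exists_adj_mem_notMem_of_connected (hconn : G.Connected) {S : Set V} {s t : V}
    (hs : s ∈ S) (ht : t ∉ S) : ∃ x ∈ S, ∃ y ∉ S, G.Adj x y := by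
  obtain ⟨w⟩ := hconn.preconnected s t
  obtain ⟨e, -, h₁, h₂⟩ := w.exists_boundary_dart S hs ht
  exact ⟨_, h₁, _, h₂, e.adj⟩

theorem count_true_ofFn : ∀ {n : ℕ} (p : Fin n → Bool),
    (List.ofFn p).count true = (Finset.univ.filter fun i => p i = true).card
  | 0, p => by simp
  | n + 1, p => by
    rw [List.ofFn_succ, List.count_cons, count_true_ofFn, Fin.card_filter_univ_succ]
    split_ifs <;> simp_all [add_comm]

theorem lazyCopsWin_two_of_diamond_labelling [Fintype V] [DecidableRel G.Adj]
    (hconn : G.Connected) (hδ : 2 ≤ G.minDegree) (hΔ : G.maxDegree ≤ 3) (f : Fin 9 ≃ V)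
    (h01 : G.Adj (f 0) (f 1)) (h02 : G.Adj (f 0) (f 2)) (h03 : G.Adj (f 0) (f 3))
    (h12 : G.Adj (f 1) (f 2)) (h13 : G.Adj (f 1) (f 3)) (h24 : G.Adj (f 2) (f 4))
    (n0 : ∀ i, G.Adj (f 0) (f i) → i = 1 ∨ i = 2 ∨ i = 3)
    (n1 : ∀ i, G.Adj (f 1) (f i) → i = 0 ∨ i = 2 ∨ i = 3)
    (n2 : ∀ i, G.Adj (f 2) (f i) → i = 0 ∨ i = 1 ∨ i = 4)
    (n3 : ∀ i, G.Adj (f 3) (f i) → i = 0 ∨ i = 1 ∨ i = 4 ∨ i = 5) :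
    LazyCopsWin G 2 := by
  classical
  have cross : ∀ k : Fin 9, 0 < k → ∃ i < k, ∃ j, k ≤ j ∧ G.Adj (f i) (f j) := by
    intro k hk
    obtain ⟨x, hx, y, hy, hxy⟩ := exists_adj_mem_notMem_of_connected hconn
      (S := {v | f.symm v < k}) (s := f 0) (t := f 8) (by simpa using hk)
      (by simp; omega)
    exact ⟨f.symm x, hx, f.symm y, not_lt.1 hy, by simpa using hxy⟩
  set a : Fin 9 → Fin 9 → Bool := fun i j => decide (G.Adj (f i) (f j)) with ha
  set A := diamondMatrix (a 3 4) (a 3 5) (a 4 5) (a 4 6) (a 4 7) (a 4 8) (a 5 6) (a 5 7) (a 5 8)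
    (a 6 7) (a 6 8) (a 7 8) with hA
  have aself : ∀ i, a i i = false := by simp [ha]
  have asymm : ∀ i j, a i j = a j i := by simp [ha, G.adj_comm]
  replace n0 : ∀ i, i ≠ 1 ∧ i ≠ 2 ∧ i ≠ 3 → a 0 i = false := by
    intro i hi; have := n0 i; simp [ha]; tauto
  replace n1 : ∀ i, i ≠ 0 ∧ i ≠ 2 ∧ i ≠ 3 → a 1 i = false := by
    intro i hi; have := n1 i; simp [ha]; tauto
  replace n2 : ∀ i, i ≠ 0 ∧ i ≠ 1 ∧ i ≠ 4 → a 2 i = false := by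
    intro i hi; have := n2 i; simp [ha]; tauto
  replace n3 : ∀ i, i ≠ 0 ∧ i ≠ 1 ∧ i ≠ 4 ∧ i ≠ 5 → a 3 i = false := by
    intro i hi; have := n3 i; simp [ha]; tauto
  replace h01 : a 0 1 = true := by simpa [ha] using h01
  replace h02 : a 0 2 = true := by simpa [ha] using h02
  replace h03 : a 0 3 = true := by simpa [ha] using h03
  replace h12 : a 1 2 = true := by simpa [ha] using h12
  replace h13 : a 1 3 = true := by simpa [ha] using h13
  replace h24 : a 2 4 = true := by simpa [ha] using h24
  have h10 : a 1 0 = true := asymm 1 0 ▸ h01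
  have h20 : a 2 0 = true := asymm 2 0 ▸ h02
  have h21 : a 2 1 = true := asymm 2 1 ▸ h12
  have hrows : A = List.ofFn fun i => List.ofFn fun j => decide (i = j) || a i j := by
    have hswap : ∀ i j, j < i → a i j = a j i := fun i j _ => asymm i j
    simp [hA, diamondMatrix, hswap, aself, n0, n1, n2, n3, h01, h02, h03, h12, h13, h24, h10, h20, h21]
  have hentry : ∀ i < 9, ∀ j < 9, (boolEntry A i j = true ↔
      f (Fin.ofNat 9 i) = f (Fin.ofNat 9 j) ∨ G.Adj (f (Fin.ofNat 9 i)) (f (Fin.ofNat 9 j))) := by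
    intro i hi j hj
    have hi' : (Fin.ofNat 9 i) = ⟨i, hi⟩ := Fin.ext (Nat.mod_eq_of_lt hi)
    have hj' : (Fin.ofNat 9 j) = ⟨j, hj⟩ := Fin.ext (Nat.mod_eq_of_lt hj)
    rw [hrows, hi', hj', f.injective.eq_iff]
    simp only [boolEntry, List.getD_eq_getElem?_getD, List.getElem?_ofFn, hi, hj, ha, dite_true,
      Option.getD_some, Bool.or_eq_true, decide_eq_true_eq]
  refine lazyCopsWin_of_searchStart (f := fun n => f (Fin.ofNat 9 n)) hentry
    (fun v => ⟨f.symm v, (f.symm v).2, by simp⟩)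
    (searchStart_diamondMatrix _ _ _ _ _ _ _ _ _ _ _ _ ?_ ?_ ?_)
  · obtain ⟨i, hi, j, hj, hij⟩ := cross 5 (by decide)
    replace hij : a i j = true := by simpa [ha] using hij
    clear_value a
    clear hA hrows hentry cross ha
    fin_cases i <;> fin_cases j <;>
      first
      | exact absurd hi (by decide)
      | exact absurd hj (by decide)
      | (exfalso; revert hij; simp [n0, n1, n2, n3]; done)
      | (simp only [Fin.reduceFinMk] at hij; simp [hij])
  · obtain ⟨i, hi, j, hj, hij⟩ := cross 6 (by decide)
    replace hij : a i j = true := by simpa [ha] using hij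
    clear_value a
    clear hA hrows hentry cross ha
    fin_cases i <;> fin_cases j <;>
      first
      | exact absurd hi (by decide)
      | exact absurd hj (by decide)
      | (exfalso; revert hij; simp [n0, n1, n2, n3]; done)
      | (simp only [Fin.reduceFinMk] at hij; simp [hij])
  · change (A.all _) = true
    rw [hrows, List.all_eq_true]
    intro l hl
    obtain ⟨i, rfl⟩ := (List.mem_ofFn' _ _).1 hl
    have hdeg : (List.ofFn fun j => decide (i = j) || a i j).count true = G.degree (f i) + 1 := by
      rw [count_true_ofFn, ← G.card_neighborFinset_eq_degree, ← Finset.card_insert_of_notMem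
        (G.notMem_neighborFinset_self (f i)), ← Finset.card_map f.toEmbedding]
      congr 1
      ext v
      obtain ⟨j, rfl⟩ := f.surjective v
      simp [ha, @eq_comm _ i j]
    have := G.minDegree_le_degree (f i)
    have := G.degree_le_maxDegree (f i)
    rw [hdeg, Bool.and_eq_true, decide_eq_true_eq, decide_eq_true_eq]
    omega

theorem eq_or_eq_or_eq_of_degree_le_three [Fintype V] [DecidableRel G.Adj] {v x₁ x₂ x₃ w : V}
    (hv : G.degree v ≤ 3) (h₁ : G.Adj v x₁) (h₂ : G.Adj v x₂) (h₃ : G.Adj v x₃)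
    (h₁₂ : x₁ ≠ x₂) (h₁₃ : x₁ ≠ x₃) (h₂₃ : x₂ ≠ x₃) (hw : G.Adj v w) :
    w = x₁ ∨ w = x₂ ∨ w = x₃ := by
  classical
  have hsub : {x₁, x₂, x₃} ⊆ G.neighborFinset v := by
    simp [Finset.insert_subset_iff, h₁, h₂, h₃]
  have heq := Finset.eq_of_subset_of_card_le hsub (by
    rw [Finset.card_eq_three.2 ⟨x₁, x₂, x₃, h₁₂, h₁₃, h₂₃, rfl⟩]; exact hv)
  simpa [← heq] using (G.mem_neighborFinset v w).2 hw

theorem lazyCopsWin_two_of_diamond [Fintype V] [DecidableRel G.Adj]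
    (hconn : G.Connected) (hcard : Fintype.card V = 9)
    (hδ : 2 ≤ G.minDegree) (hΔ : G.maxDegree ≤ 3) {u₁ u₂ y z a : V}
    (hyz : y ≠ z) (huu : G.Adj u₁ u₂) (h1y : G.Adj u₁ y) (h1z : G.Adj u₁ z)
    (h2y : G.Adj u₂ y) (h2z : G.Adj u₂ z) (hya : G.Adj y a)
    (ha1 : a ≠ u₁) (ha2 : a ≠ u₂) (haz : a ≠ z) : LazyCopsWin G 2 := by
  classical
  have hdeg : ∀ v, G.degree v ≤ 3 := fun v => (G.degree_le_maxDegree v).trans hΔ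
  have n1 := fun w => eq_or_eq_or_eq_of_degree_le_three (w := w) (hdeg u₁) huu h1y h1z
    h2y.ne h2z.ne hyz
  have n2 := fun w => eq_or_eq_or_eq_of_degree_le_three (w := w) (hdeg u₂) huu.symm h2y h2z
    h1y.ne h1z.ne hyz
  have ny := fun w => eq_or_eq_or_eq_of_degree_le_three (w := w) (hdeg y) h1y.symm h2y.symm hya
    huu.ne ha1.symm ha2.symm
  have hzy : ¬ G.Adj z y := fun h => by
    rcases ny z h.symm with h | h | h
    exacts [h1z.ne h.symm, h2z.ne h.symm, haz h.symm]
  obtain ⟨b, hb1, hb2, hby, hbz, hba, nz⟩ : ∃ b, b ≠ u₁ ∧ b ≠ u₂ ∧ b ≠ y ∧ b ≠ z ∧ b ≠ a ∧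
      ∀ w, G.Adj z w → w = u₁ ∨ w = u₂ ∨ w = a ∨ w = b := by
    by_cases h : ∃ b, G.Adj z b ∧ b ≠ u₁ ∧ b ≠ u₂ ∧ b ≠ a
    · obtain ⟨b, hzb, hb1, hb2, hba⟩ := h
      refine ⟨b, hb1, hb2, fun h => hzy (h ▸ hzb), hzb.ne', hba, fun w hw => ?_⟩
      have := eq_or_eq_or_eq_of_degree_le_three (hdeg z) h1z.symm h2z.symm hzb huu.ne hb1.symm
        hb2.symm hw
      tauto
    · push Not at h
      obtain ⟨b, hb⟩ : ∃ b, b ∉ ({u₁, u₂, y, z, a} : Finset V) := by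
        by_contra! hall
        have := Finset.card_le_card (fun v _ => hall v : Finset.univ ⊆ _)
        have := Finset.card_le_five (a := u₁) (b := u₂) (c := y) (d := z) (e := a)
        simp only [Finset.card_univ, hcard] at *
        omega
      simp only [Finset.mem_insert, Finset.mem_singleton, not_or] at hb
      obtain ⟨hb1, hb2, hby, hbz, hba⟩ := hb
      refine ⟨b, hb1, hb2, hby, hbz, hba, fun w hw => ?_⟩
      have := h w hw
      tauto
  have hya' := hya.ne
  have h12' := huu.ne
  have h1y' := h1y.ne
  have h1z' := h1z.ne
  have h2y' := h2y.ne
  have h2z' := h2z.ne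
  obtain ⟨f, hf⟩ := Finset.exists_equiv_extend_of_card_eq (α := Fin 9) (β := V)
    (t := Finset.univ) (s := {0, 1, 2, 3, 4, 5}) (f := ![u₁, u₂, y, z, a, b, u₁, u₁, u₁])
    (by simp [hcard]) (Finset.subset_univ _) (by
      simp [Set.InjOn, ha1, ha2, haz, hb1, hb2, hby, hbz, hba, hyz, hya', h12', h1y', h1z', h2y',
        h2z', ha1.symm, ha2.symm, haz.symm, hb1.symm, hb2.symm, hby.symm, hbz.symm, hba.symm,
        hyz.symm, hya'.symm, h12'.symm, h1y'.symm, h1z'.symm, h2y'.symm, h2z'.symm])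
  let g : Fin 9 ≃ V := f.trans (Equiv.subtypeUnivEquiv Finset.mem_univ)
  have g0 : g 0 = u₁ := hf 0 (by decide)
  have g1 : g 1 = u₂ := hf 1 (by decide)
  have g2 : g 2 = y := hf 2 (by decide)
  have g3 : g 3 = z := hf 3 (by decide)
  have g4 : g 4 = a := hf 4 (by decide)
  have g5 : g 5 = b := hf 5 (by decide)
  clear_value g
  refine lazyCopsWin_two_of_diamond_labelling hconn hδ hΔ g ?_ ?_ ?_ ?_ ?_ ?_
    (fun i hi => ?_) (fun i hi => ?_) (fun i hi => ?_) (fun i hi => ?_)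
  iterate 6 simpa only [g0, g1, g2, g3, g4]
  · have h := n1 _ (g0 ▸ hi)
    simp only [← g1, ← g2, ← g3] at h
    simpa only [g.injective.eq_iff] using h
  · have h := n2 _ (g1 ▸ hi)
    simp only [← g0, ← g2, ← g3] at h
    simpa only [g.injective.eq_iff] using h
  · have h := ny _ (g2 ▸ hi)
    simp only [← g0, ← g1, ← g4] at h
    simpa only [g.injective.eq_iff] using h
  · have h := nz _ (g3 ▸ hi)
    simp only [← g0, ← g1, ← g4, ← g5] at h
    simpa only [g.injective.eq_iff] using h

end

/-- 9 vertices, `2 ≤ δ(G) ≤ Δ(G) ≤ 3`, and two adjacent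
degree-3 vertices with exactly two common neighbors `y, z` imply
`c_L(G) ≤ 2`. -/
theorem lazy_le_two_of_adjacent_two_common_neighbors
    {V : Type*} [Fintype V] [Nonempty V] (G : SimpleGraph V)
    [DecidableRel G.Adj] (hconn : G.Connected)
    (hcard : Fintype.card V = 9)
    (hδ : 2 ≤ G.minDegree) (hΔ : G.maxDegree ≤ 3)
    (u₁ u₂ : V) (h1 : G.degree u₁ = 3) (h2 : G.degree u₂ = 3)
    (hadj : G.Adj u₁ u₂)
    (y z : V) (hyz : y ≠ z)
    (hy1 : y ≠ u₁) (hy2 : y ≠ u₂) (hz1 : z ≠ u₁) (hz2 : z ≠ u₂)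
    (hN : insert u₁ (G.neighborSet u₁) ∩ insert u₂ (G.neighborSet u₂) =
      {u₁, u₂, y, z}) :
    lazyCopNumber G ≤ 2 := by
  have hmem : ∀ v, v = y ∨ v = z → v ∈ insert u₁ (G.neighborSet u₁) ∩
      insert u₂ (G.neighborSet u₂) := by
    rintro v (rfl | rfl) <;> simp [hN]
  have h1y : G.Adj u₁ y := ((hmem y (.inl rfl)).1.resolve_left hy1)
  have h2y : G.Adj u₂ y := ((hmem y (.inl rfl)).2.resolve_left hy2)
  have h1z : G.Adj u₁ z := ((hmem z (.inr rfl)).1.resolve_left hz1)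
  have h2z : G.Adj u₂ z := ((hmem z (.inr rfl)).2.resolve_left hz2)
  refine Nat.sInf_le ?_
  classical
  obtain ⟨t, ht⟩ : ∃ t, t ∉ ({u₁, u₂, y, z} : Finset V) := by
    by_contra! hall
    have := Finset.card_le_card (fun v _ => hall v : Finset.univ ⊆ _)
    have := Finset.card_le_four (a := u₁) (b := u₂) (c := y) (d := z)
    simp only [Finset.card_univ, hcard] at *
    omega
  obtain ⟨x, hx, w, hw, hxw⟩ := exists_adj_mem_notMem_of_connected hconn
    (S := (({u₁, u₂, y, z} : Finset V) : Set V)) (s := u₁) (by simp) ht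
  simp only [Finset.coe_insert, Finset.coe_singleton, Set.mem_insert_iff, Set.mem_singleton_iff,
    not_or] at hx hw
  obtain ⟨hw1, hw2, hwy, hwz⟩ := hw
  obtain rfl | rfl | rfl | rfl := hx
  · obtain h | h | h := eq_or_eq_or_eq_of_degree_le_three h1.le hadj h1y h1z hy2.symm hz2.symm
      hyz hxw <;> contradiction
  · obtain h | h | h := eq_or_eq_or_eq_of_degree_le_three h2.le hadj.symm h2y h2z hy1.symm
      hz1.symm hyz hxw <;> contradiction
  · exact lazyCopsWin_two_of_diamond hconn hcard hδ hΔ hyz hadj h1y h1z h2y h2z hxw hw1 hw2 hwz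
  · exact lazyCopsWin_two_of_diamond hconn hcard hδ hΔ hyz.symm hadj h1z h1y h2z h2y hxw hw1 hw2
      hwy

end CopsRobbers
end

section
/- If G is a finite connected simple graph on n vertices whose maximum degree satisfies Δ(G) ≥ n − 9, then c_L(G) ≤ 3. -/
/-!
Cops and robbers on a simple graph `G`.

A *configuration* consists of the positions of the `k` cops (a function
`Fin k → V`) together with the robber's position, with the cops to move.
The cops win if at some point a cop occupies the robber's vertex.
-/

namespace CopsRobbers

variable {V : Type*}

/-- A robber standing on or next to a cop is caught by lazy cops. -/
theorem LazyWinFrom.of_attacked {G : SimpleGraph V} {k : ℕ} {c : Fin k → V} {r : V} (i : Fin k)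
    (h : c i = r ∨ G.Adj (c i) r) : LazyWinFrom G c r := by
  classical
  rcases h with h | h
  · exact .caught i h
  · exact .stepCatch (Function.update c i r) i (by simp [h])
      (fun l hl => by simp [hl]) i (by simp)

/-- The robber cannot leave `R` without stepping on or next to one of the cops in `I`. -/
def Confined (G : SimpleGraph V) {k : ℕ} (c : Fin k → V) (I : Set (Fin k)) (R : Finset V) : Prop :=
  ∀ r ∈ R, ∀ r', G.Adj r r' → r' ∈ R ∨ ∃ i ∈ I, c i = r' ∨ G.Adj (c i) r'

theorem Confined.congr {G : SimpleGraph V} {k : ℕ} {c c' : Fin k → V} {I : Set (Fin k)}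
    {R : Finset V} (h : Confined G c I R) (hc : ∀ i ∈ I, c' i = c i) : Confined G c' I R := by
  intro r hr r' hr'
  rcases h r hr r' hr' with h | ⟨i, hi, h⟩
  · exact .inl h
  · exact .inr ⟨i, hi, by rwa [hc i hi]⟩

/-- A part of a confining region without edges to the rest of it is itself confining. -/
theorem Confined.subset {G : SimpleGraph V} {k : ℕ} {c : Fin k → V} {I : Set (Fin k)}
    {R S : Finset V} (h : Confined G c I R) (hS : S ⊆ R)
    (hSR : ∀ x ∈ S, ∀ y ∈ R, G.Adj x y → y ∈ S) : Confined G c I S := by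
  intro r hr r' hr'
  exact (h r (hS hr) r' hr').imp_left fun h => hSR r hr r' h hr'

/-- While the other cops confine the robber, a free cop can walk to any vertex it can reach. -/
theorem Confined.win_of_walk {G : SimpleGraph V} {k : ℕ} {I : Set (Fin k)} {R : Finset V}
    {j : Fin k} (hj : j ∉ I) {x y : V} (p : G.Walk x y) :
    ∀ {c : Fin k → V}, c j = x → Confined G c I R →
      (∀ r ∈ R, LazyWinFrom G (Function.update c j y) r) → ∀ r ∈ R, LazyWinFrom G c r := by
  induction p with
  | nil =>
    rintro c rfl - h
    simpa using h
  | @cons x z y hxz p ih =>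
    rintro c rfl hc h r hr
    have hfix : ∀ i ≠ j, Function.update c j z i = c i := fun i hi => by simp [hi]
    have hI : ∀ i ∈ I, Function.update c j z i = c i :=
      fun i hi => hfix i (ne_of_mem_of_not_mem hi hj)
    have hwin := ih (by simp) (hc.congr hI) (by simpa using h)
    refine .step (Function.update c j z) j (by simp [hxz]) hfix ?_
    rintro r' (rfl | hr')
    · exact hwin r' hr
    · rcases hc r hr r' hr' with h' | ⟨i, hi, h'⟩
      · exact hwin r' h'
      · exact .of_attacked i (by rwa [hI i hi])

/-- A free cop at `y` wins in a confining region if every vertex of the region is attacked from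
`y`, or has all its moves attacked from a vertex that the cop can move to. -/
theorem Confined.win_of_almost_dominating {G : SimpleGraph V} {k : ℕ} (hG : G.Connected)
    {I : Set (Fin k)} {R : Finset V} {j : Fin k} (hj : j ∉ I) {c : Fin k → V}
    (hc : Confined G c I R) (y : V)
    (hy : ∀ r ∈ R, (y = r ∨ G.Adj y r) ∨ ∃ z, G.Adj y z ∧
      ∀ r' ∈ R, (r' = r ∨ G.Adj r r') → z = r' ∨ G.Adj z r') :
    ∀ r ∈ R, LazyWinFrom G c r := by
  obtain ⟨p⟩ := hG.preconnected (c j) y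
  refine hc.win_of_walk hj p rfl fun r hr => ?_
  rcases hy r hr with h | ⟨z, hz, h⟩
  · exact .of_attacked j (by simpa using h)
  · have hI : ∀ i ∈ I, Function.update c j z i = c i :=
      fun i hi => by simp [ne_of_mem_of_not_mem hi hj]
    refine .step (Function.update c j z) j (by simp [hz]) (fun i hi => by simp [hi]) ?_
    intro r' hr'
    by_cases hR : r' ∈ R
    · exact .of_attacked j (by simpa using h r' hR hr')
    · rcases hr' with rfl | hr'
      · exact absurd hr hR
      · rcases hc r hr r' hr' with h' | ⟨i, hi, h'⟩
        · exact absurd h' hR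
        · exact .of_attacked i (by rwa [hI i hi])

section Finset

variable (G : SimpleGraph V) [DecidableRel G.Adj]

/-- The neighbours of `x` inside `R`. -/
def nbrIn (R : Finset V) (x : V) : Finset V := R.filter (G.Adj x)

variable {G} in
@[simp] theorem mem_nbrIn {R : Finset V} {x y : V} : y ∈ nbrIn G R x ↔ y ∈ R ∧ G.Adj x y := by
  simp [nbrIn]

variable [DecidableEq V]

/-- The vertices of `R` outside the closed neighbourhood of `x`. -/
def farIn (R : Finset V) (x : V) : Finset V := R.filter fun y => x ≠ y ∧ ¬ G.Adj x y

variable {G}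

@[simp] theorem mem_farIn {R : Finset V} {x y : V} :
    y ∈ farIn G R x ↔ y ∈ R ∧ x ≠ y ∧ ¬ G.Adj x y := by
  simp [farIn]

theorem card_farIn_add {R : Finset V} {x : V} (hx : x ∈ R) :
    (farIn G R x).card + (nbrIn G R x).card + 1 = R.card := by
  have hdisj : Disjoint (farIn G R x) (nbrIn G R x) := by
    rw [Finset.disjoint_left]
    simp only [mem_farIn, mem_nbrIn]
    tauto
  have hnot : x ∉ farIn G R x ∪ nbrIn G R x := by simp
  rw [← Finset.card_union_of_disjoint hdisj, ← Finset.card_insert_of_notMem hnot]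
  congr 1
  ext y
  simp only [Finset.mem_insert, Finset.mem_union, mem_farIn, mem_nbrIn]
  by_cases h : y = x
  · simp [h, hx]
  · have := Ne.symm h
    tauto

/-- One free cop wins in a confining region with at most four vertices that is not a 4-cycle. -/
theorem Confined.win_or_fourCycle (hG : G.Connected) {k : ℕ} {I : Set (Fin k)} {j : Fin k}
    (hj : j ∉ I) {c : Fin k → V} (R : Finset V) (hc : Confined G c I R) (hR : R.card ≤ 4) :
    (∀ r ∈ R, LazyWinFrom G c r) ∨ (R.card = 4 ∧ ∀ x ∈ R, (nbrIn G R x).card = 2) := by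
  induction R using Finset.strongInduction with
  | H R ih =>
  have split : ∀ S ⊆ R, S.Nonempty → S ≠ R → (∀ x ∈ S, ∀ y ∈ R, G.Adj x y → y ∈ S) →
      ∀ r ∈ R, LazyWinFrom G c r := by
    intro S hSR hne hS hadj
    have key : ∀ T ⊂ R, Confined G c I T → ∀ r ∈ T, LazyWinFrom G c r := by
      intro T hT hcT
      have hlt := Finset.card_lt_card hT
      rcases ih T hT hcT (by omega) with h | ⟨h, -⟩
      · exact h
      · omega
    intro r hr
    by_cases hrS : r ∈ S
    · exact key S (hSR.ssubset_of_ne hS) (hc.subset hSR hadj) r hrS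
    · refine key (R \ S) (Finset.sdiff_ssubset hSR hne)
        (hc.subset Finset.sdiff_subset ?_) r (by simp [hr, hrS])
      intro x hx y hy hxy
      simp only [Finset.mem_sdiff] at hx ⊢
      exact ⟨hy, fun hyS => hx.2 (hadj y hyS x hx.1 hxy.symm)⟩
  by_contra! hcon
  obtain ⟨⟨r₀, hr₀, hlose⟩, hcyc⟩ := hcon
  have hfar : ∀ x ∈ R, (farIn G R x).Nonempty := by
    intro x hx
    by_contra hempty
    refine hlose (hc.win_of_almost_dominating hG hj x (fun r hr => .inl ?_) r₀ hr₀)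
    by_contra! h
    exact hempty ⟨r, by simpa [hr] using h⟩
  have hdeg : ∀ x ∈ R, 1 ≤ (nbrIn G R x).card := by
    intro x hx
    by_contra! h
    have h0 : nbrIn G R x = ∅ := by simpa using h
    have h1 := card_farIn_add (G := G) hx
    have h2 := (hfar x hx).card_pos
    refine hlose (split {x} (by simpa using hx) (by simp) ?_ ?_ r₀ hr₀)
    · intro h
      have := congrArg Finset.card h
      rw [Finset.card_singleton] at this
      omega
    · simp only [Finset.mem_singleton]
      rintro _ rfl y hy hxy
      have : y ∈ nbrIn G R _ := mem_nbrIn.2 ⟨hy, hxy⟩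
      simp [h0] at this
  have hsum : ∀ x ∈ R, (nbrIn G R x).card + 2 ≤ R.card := by
    intro x hx
    have h1 := card_farIn_add (G := G) hx
    have h2 := (hfar x hx).card_pos
    omega
  obtain ⟨x, hx, hx1⟩ : ∃ x ∈ R, (nbrIn G R x).card = 1 := by
    by_contra! h
    have h2 : ∀ x ∈ R, (nbrIn G R x).card = 2 := by
      intro x hx
      have := h x hx
      have := hdeg x hx
      have := hsum x hx
      omega
    have h4 : R.card = 4 := by
      have := hsum r₀ hr₀
      have := h2 r₀ hr₀
      omega
    obtain ⟨y, hy, hy'⟩ := hcyc h4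
    exact hy' (h2 y hy)
  obtain ⟨y, hxy⟩ := Finset.card_eq_one.1 hx1
  have hy : y ∈ R ∧ G.Adj x y := mem_nbrIn.1 (by simp [hxy])
  have hxuniq : ∀ z ∈ R, G.Adj x z → z = y := fun z hz hxz => by
    have : z ∈ nbrIn G R x := mem_nbrIn.2 ⟨hz, hxz⟩
    simpa [hxy] using this
  have hxmem : x ∈ nbrIn G R y := mem_nbrIn.2 ⟨hx, hy.2.symm⟩
  have hy1 := hdeg y hy.1
  have hy2 := hsum y hy.1
  have hyfar := card_farIn_add (G := G) hy.1
  rcases (show (nbrIn G R y).card = 1 ∨ (nbrIn G R y).card = 2 by omega) with h1 | h2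
  · obtain ⟨x', hx'⟩ := Finset.card_eq_one.1 h1
    obtain rfl : x = x' := by simpa [hx'] using hxmem
    refine hlose (split {x, y} ?_ (by simp) ?_ ?_ r₀ hr₀)
    · intro z
      simp only [Finset.mem_insert, Finset.mem_singleton]
      rintro (rfl | rfl)
      exacts [hx, hy.1]
    · rintro rfl
      have := Finset.card_le_two (a := x) (b := y)
      omega
    · simp only [Finset.mem_insert, Finset.mem_singleton]
      rintro a (rfl | rfl) b hb hab
      · exact .inr (hxuniq b hb hab)
      · have : b ∈ nbrIn G R a := mem_nbrIn.2 ⟨hb, hab⟩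
        exact .inl (by simpa [hx'] using this)
  · refine hlose (hc.win_of_almost_dominating hG hj y (fun w hw => ?_) r₀ hr₀)
    by_cases hyw : y = w ∨ G.Adj y w
    · exact .inl hyw
    right
    have hyw' : w ∈ farIn G R y := by simpa [hw] using hyw
    have huniq : ∀ v ∈ farIn G R y, v = w := fun v hv =>
      Finset.card_le_one.1 (by omega) v hv w hyw'
    have hnbr : ∀ v ∈ R, G.Adj w v → G.Adj y v ∧ v ≠ x := by
      intro v hv hwv
      have hvx : v ≠ x := by
        rintro rfl
        exact hyw (.inl (hxuniq w hw hwv.symm).symm)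
      refine ⟨?_, hvx⟩
      by_contra hyv
      refine hwv.ne (huniq v (mem_farIn.2 ⟨hv, ?_, hyv⟩)).symm
      rintro rfl
      exact hyw (.inr hwv.symm)
    obtain ⟨z, hz⟩ := Finset.card_pos.1 (hdeg w hw)
    obtain ⟨hzR, hwz⟩ := mem_nbrIn.1 hz
    obtain ⟨hyz, hzx⟩ := hnbr z hzR hwz
    refine ⟨z, hyz, ?_⟩
    rintro v hv (rfl | hwv)
    · exact .inr hwz.symm
    · obtain ⟨hyv, hvx⟩ := hnbr v hv hwv
      left
      by_contra hzv
      have hsub : ({x, z, v} : Finset V) ⊆ nbrIn G R y := by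
        intro a
        simp only [Finset.mem_insert, Finset.mem_singleton]
        rintro (rfl | rfl | rfl)
        exacts [hxmem, mem_nbrIn.2 ⟨hzR, hyz⟩, mem_nbrIn.2 ⟨hv, hyv⟩]
      have := Finset.card_le_card hsub
      rw [Finset.card_eq_three.2 ⟨x, z, v, hzx.symm, hvx.symm, hzv, rfl⟩] at this
      omega

/-- In a region of maximum degree at most two, free cops each having at most one neighbour in the
robber's territory `K` sweep `K`, or else the robber gets confined to a smaller region. -/
theorem win_of_sweep {k : ℕ} {I : Set (Fin k)} {R : Finset V}
    (hdeg : ∀ x ∈ R, (nbrIn G R x).card ≤ 2) (K : Finset V) (hKR : K ⊂ R) (c : Fin k → V)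
    (ih : ∀ K ⊂ R, ∀ c' : Fin k → V, (∀ i ∈ I, c' i = c i) → Confined G c' I K →
      ∀ r ∈ K, LazyWinFrom G c' r)
    (hcR : ∀ i ∉ I, c i ∈ R ∧ c i ∉ K ∧ (nbrIn G K (c i)).card ≤ 1)
    (hK : ∀ r ∈ K, ∀ r', G.Adj r r' → r' ∈ K ∨ (∃ i ∈ I, c i = r' ∨ G.Adj (c i) r') ∨
      ∃ i ∉ I, c i = r') :
    ∀ r ∈ K, LazyWinFrom G c r := by
  induction K using Finset.strongInduction generalizing c with
  | H K ihK =>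
  intro r hr
  by_cases hex : ∃ i ∉ I, ∃ y ∈ K, G.Adj (c i) y
  · obtain ⟨i, hi, y, hy, hiy⟩ := hex
    have huniq : ∀ z ∈ K, G.Adj (c i) z → z = y := fun z hz hiz =>
      Finset.card_le_one.1 (hcR i hi).2.2 z (mem_nbrIn.2 ⟨hz, hiz⟩) y (mem_nbrIn.2 ⟨hy, hiy⟩)
    by_cases hry : r = y
    · exact .of_attacked i (.inr (hry ▸ hiy))
    have hfix : ∀ l ≠ i, Function.update c i y l = c l := fun l hl => by simp [hl]
    have hI : ∀ l ∈ I, Function.update c i y l = c l :=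
      fun l hl => hfix l (ne_of_mem_of_not_mem hl hi)
    have hwin : ∀ r ∈ K.erase y, LazyWinFrom G (Function.update c i y) r := by
      refine ihK (K.erase y) (Finset.erase_ssubset hy)
        ((Finset.erase_subset y K).trans_ssubset hKR) _ ?_ ?_ ?_
      · exact fun L hL c' hc' => ih L hL c' fun l hl => (hc' l hl).trans (hI l hl)
      · intro l hl
        by_cases hli : l = i
        · subst hli
          simp only [Function.update_self]
          refine ⟨hKR.1 hy, by simp, ?_⟩
          have hmem : c l ∈ nbrIn G R y := mem_nbrIn.2 ⟨(hcR l hl).1, hiy.symm⟩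
          have hsub : nbrIn G (K.erase y) y ⊆ (nbrIn G R y).erase (c l) := by
            intro z hz
            obtain ⟨hz, hyz⟩ := mem_nbrIn.1 hz
            have hzK := Finset.mem_of_mem_erase hz
            refine Finset.mem_erase.2 ⟨?_, mem_nbrIn.2 ⟨hKR.1 hzK, hyz⟩⟩
            rintro rfl
            exact (hcR l hl).2.1 hzK
          have h1 := Finset.card_le_card hsub
          rw [Finset.card_erase_of_mem hmem] at h1
          have := hdeg y (hKR.1 hy)
          omega
        · rw [hfix l hli]
          obtain ⟨h1, h2, h3⟩ := hcR l hl
          refine ⟨h1, fun h => h2 (Finset.mem_of_mem_erase h), le_trans (Finset.card_le_card ?_) h3⟩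
          exact Finset.filter_subset_filter _ (Finset.erase_subset y K)
      · intro s hs s' hss'
        obtain ⟨hsy, hsK⟩ := Finset.mem_erase.1 hs
        rcases hK s hsK s' hss' with h | ⟨l, hl, h⟩ | ⟨l, hl, h⟩
        · by_cases hs'y : s' = y
          · exact .inr (.inr ⟨i, hi, by simp [hs'y]⟩)
          · exact .inl (Finset.mem_erase.2 ⟨hs'y, h⟩)
        · exact .inr (.inl ⟨l, hl, by rwa [hI l hl]⟩)
        · by_cases hli : l = i
          · subst hli h
            exact absurd (huniq s hsK hss'.symm) hsy
          · exact .inr (.inr ⟨l, hl, by rwa [hfix l hli]⟩)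
    refine .step (Function.update c i y) i (by simp [hiy]) hfix ?_
    rintro r' (rfl | hr')
    · exact hwin r' (Finset.mem_erase.2 ⟨hry, hr⟩)
    · rcases hK r hr r' hr' with h | ⟨l, hl, h⟩ | ⟨l, hl, h⟩
      · by_cases hr'y : r' = y
        · exact .caught i (by simp [hr'y])
        · exact hwin r' (Finset.mem_erase.2 ⟨hr'y, h⟩)
      · exact .of_attacked l (by rwa [hI l hl])
      · by_cases hli : l = i
        · subst hli h
          exact absurd (huniq r hr hr'.symm) hry
        · exact .caught l (by rwa [hfix l hli])
  · push Not at hex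
    refine ih K hKR c (fun _ _ => rfl) (fun s hs s' hss' => ?_) r hr
    rcases hK s hs s' hss' with h | h | ⟨i, hi, rfl⟩
    · exact .inl h
    · exact .inr h
    · exact absurd hss'.symm (hex i hi s hs)

/-- A graph of maximum degree three cannot have the non-neighbourhoods of two nonadjacent
vertices of degree three both inducing a 4-cycle. -/
theorem not_two_fourCycles {R : Finset V} (hdeg : ∀ x ∈ R, (nbrIn G R x).card ≤ 3)
    {u w : V} (hw : w ∈ farIn G R u) (hu4 : (farIn G R u).card = 4)
    (hu2 : ∀ x ∈ farIn G R u, (nbrIn G (farIn G R u) x).card = 2)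
    (hw2 : ∀ x ∈ farIn G R w, (nbrIn G (farIn G R w) x).card = 2) : False := by
  have hone : (farIn G (farIn G R u) w).card = 1 := by
    have := card_farIn_add (G := G) hw
    have := hu2 w hw
    omega
  obtain ⟨t, ht⟩ := Finset.card_eq_one.1 hone
  have htmem : t ∈ farIn G (farIn G R u) w := by simp [ht]
  obtain ⟨htu, htw⟩ := mem_farIn.1 htmem
  have htR := (mem_farIn.1 htu).1
  have hdisj : Disjoint (nbrIn G (farIn G R u) t) (nbrIn G (farIn G R w) t) := by
    rw [Finset.disjoint_left]
    intro s hs hs'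
    obtain ⟨hsu, hts⟩ := mem_nbrIn.1 hs
    obtain ⟨hsw, -⟩ := mem_nbrIn.1 hs'
    have : s ∈ farIn G (farIn G R u) w := mem_farIn.2 ⟨hsu, (mem_farIn.1 hsw).2⟩
    rw [ht, Finset.mem_singleton] at this
    exact hts.ne this.symm
  have hsub : nbrIn G (farIn G R u) t ∪ nbrIn G (farIn G R w) t ⊆ nbrIn G R t :=
    Finset.union_subset (Finset.filter_subset_filter _ (Finset.filter_subset _ _))
      (Finset.filter_subset_filter _ (Finset.filter_subset _ _))
  have h1 := Finset.card_le_card hsub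
  rw [Finset.card_union_of_disjoint hdisj, hu2 t htu, hw2 t (mem_farIn.2 ⟨htR, htw⟩)] at h1
  have := hdeg t htR
  omega

/-- Two free lazy cops win in a region with at most eight vertices confined by a third cop. -/
theorem Confined.win_of_card_le_eight (hG : G.Connected) (R : Finset V) (hR : R.card ≤ 8)
    (c : Fin 3 → V) (hc : Confined G c {0} R) : ∀ r ∈ R, LazyWinFrom G c r := by
  induction R using Finset.strongInduction generalizing c with
  | H R ih =>
  have ih' : ∀ K ⊂ R, ∀ c : Fin 3 → V, Confined G c {0} K → ∀ r ∈ K, LazyWinFrom G c r :=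
    fun K hK c => ih K hK ((Finset.card_le_card hK.1).trans hR) c
  have split : ∀ S ⊆ R, S.Nonempty → S ≠ R → (∀ x ∈ S, ∀ y ∈ R, G.Adj x y → y ∈ S) →
      ∀ r ∈ R, LazyWinFrom G c r := by
    intro S hSR hne hS hadj r hr
    by_cases hrS : r ∈ S
    · exact ih' S (hSR.ssubset_of_ne hS) c (hc.subset hSR hadj) r hrS
    · refine ih' (R \ S) (Finset.sdiff_ssubset hSR hne) c
        (hc.subset Finset.sdiff_subset ?_) r (by simp [hr, hrS])
      intro x hx y hy hxy
      simp only [Finset.mem_sdiff] at hx ⊢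
      exact ⟨hy, fun hyS => hx.2 (hadj y hyS x hx.1 hxy.symm)⟩
  by_contra! hcon
  obtain ⟨r₀, hr₀, hlose⟩ := hcon
  have hcyc : ∀ u ∈ R, 3 ≤ (nbrIn G R u).card → (farIn G R u).card = 4 ∧
      ∀ x ∈ farIn G R u, (nbrIn G (farIn G R u) x).card = 2 := by
    intro u hu h3
    obtain ⟨p⟩ := hG.preconnected (c 1) u
    have hu' : Function.update c 1 u 1 = u := by simp
    have h0 : Function.update c 1 u 0 = c 0 := by simp
    have hconf : Confined G (Function.update c 1 u) {0, 1} (farIn G R u) := by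
      intro r hr r' hr'
      rcases hc r (mem_farIn.1 hr).1 r' hr' with h | ⟨i, hi, h⟩
      · by_cases hur : u = r' ∨ G.Adj u r'
        · exact .inr ⟨1, by simp, by rwa [hu']⟩
        · exact .inl (mem_farIn.2 ⟨h, by simpa using hur⟩)
      · obtain rfl : i = 0 := hi
        exact .inr ⟨0, by simp, by rwa [h0]⟩
    have hcard := card_farIn_add (G := G) hu
    refine (hconf.win_or_fourCycle hG (j := 2) (by simp) _ (by omega)).resolve_left fun hwin => ?_
    refine hlose (hc.win_of_walk (j := 1) (by simp) p rfl (fun r hr => ?_) r₀ hr₀)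
    by_cases hur : u = r ∨ G.Adj u r
    · exact .of_attacked 1 (by rwa [hu'])
    · exact hwin r (mem_farIn.2 ⟨hr, by simpa using hur⟩)
  have hdeg3 : ∀ x ∈ R, (nbrIn G R x).card ≤ 3 := by
    intro x hx
    by_contra! h
    have := (hcyc x hx h.le).1
    have := card_farIn_add (G := G) hx
    omega
  by_cases hdeg2 : ∀ x ∈ R, (nbrIn G R x).card ≤ 2
  · by_cases hiso : nbrIn G R r₀ = ∅
    · by_cases hRr : {r₀} = R
      · refine hlose (hc.win_of_almost_dominating hG (j := 1) (by simp) r₀ ?_ r₀ hr₀)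
        intro r hr
        rw [← hRr, Finset.mem_singleton] at hr
        exact .inl (.inl hr.symm)
      · refine hlose (split {r₀} (by simpa using hr₀) (by simp) hRr ?_ r₀ hr₀)
        simp only [Finset.mem_singleton]
        rintro _ rfl y hy hxy
        have : y ∈ nbrIn G R _ := mem_nbrIn.2 ⟨hy, hxy⟩
        simp [hiso] at this
    · obtain ⟨y, hy⟩ := Finset.nonempty_iff_ne_empty.2 hiso
      obtain ⟨hyR, hry⟩ := mem_nbrIn.1 hy
      obtain ⟨p⟩ := hG.preconnected (c 1) r₀
      obtain ⟨q⟩ := hG.preconnected (c 2) y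
      refine hlose (hc.win_of_walk (j := 1) (by simp) p rfl ?_ r₀ hr₀)
      refine Confined.win_of_walk (j := 2) (I := {0}) (by simp) q (by simp)
        (hc.congr (by simp)) ?_
      set d : Fin 3 → V := Function.update (Function.update c 1 r₀) 2 y with hd
      have hd0 : d 0 = c 0 := by simp [hd]
      have hd1 : d 1 = r₀ := by simp [hd]
      have hd2 : d 2 = y := by simp [hd]
      have hnbr : ∀ a ∈ R, ∀ b ∈ R, G.Adj a b → ∀ K ⊆ R, b ∉ K → (nbrIn G K a).card ≤ 1 := by
        intro a ha b hb hab K hK hbK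
        have hsub : nbrIn G K a ⊆ (nbrIn G R a).erase b := by
          intro z hz
          obtain ⟨hz, haz⟩ := mem_nbrIn.1 hz
          exact Finset.mem_erase.2 ⟨ne_of_mem_of_not_mem hz hbK, mem_nbrIn.2 ⟨hK hz, haz⟩⟩
        have h1 := Finset.card_le_card hsub
        rw [Finset.card_erase_of_mem (mem_nbrIn.2 ⟨hb, hab⟩)] at h1
        have := hdeg2 a ha
        omega
      have hsub : (R.erase r₀).erase y ⊆ R := (Finset.erase_subset _ _).trans
        (Finset.erase_subset _ _)
      have hwin : ∀ r ∈ (R.erase r₀).erase y, LazyWinFrom G d r := by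
        refine win_of_sweep (I := {0}) hdeg2 _
          ((Finset.erase_subset _ _).trans_ssubset (Finset.erase_ssubset hr₀)) d
          (fun K hK c' _ => ih' K hK c') ?_ ?_
        · intro i hi
          obtain rfl | rfl : i = 1 ∨ i = 2 := by
            simp only [Set.mem_singleton_iff] at hi
            omega
          · rw [hd1]
            exact ⟨hr₀, by simp, hnbr r₀ hr₀ y hyR hry _ hsub (by simp)⟩
          · rw [hd2]
            exact ⟨hyR, by simp, hnbr y hyR r₀ hr₀ hry.symm _ hsub (by simp)⟩
        · intro s hs s' hss'
          rcases hc s (hsub hs) s' hss' with h | ⟨i, hi, h⟩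
          · by_cases h1 : s' = r₀
            · exact .inr (.inr ⟨1, by simp, by rw [hd1, h1]⟩)
            by_cases h2 : s' = y
            · exact .inr (.inr ⟨2, by simp, by rw [hd2, h2]⟩)
            · exact .inl (by simp [h, h1, h2])
          · obtain rfl : i = 0 := hi
            exact .inr (.inl ⟨0, rfl, by rwa [hd0]⟩)
      intro r hr
      by_cases h1 : r = r₀
      · exact .caught 1 (by rw [hd1, h1])
      by_cases h2 : r = y
      · exact .caught 2 (by rw [hd2, h2])
      · exact hwin r (by simp [hr, h1, h2])
  · push Not at hdeg2
    obtain ⟨u, hu, hu3⟩ := hdeg2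
    obtain ⟨hu4, hu2⟩ := hcyc u hu hu3
    have hsub : farIn G R u ⊆ R := Finset.filter_subset _ _
    refine hlose (split (farIn G R u) hsub (Finset.card_pos.1 (by omega)) ?_ ?_ r₀ hr₀)
    · intro h
      have hmem := hu
      rw [← h] at hmem
      simp at hmem
    · intro w hw y hy hwy
      have hle : (nbrIn G R w).card ≤ 2 := by
        by_contra! h
        exact not_two_fourCycles hdeg3 hw hu4 hu2 (hcyc w (hsub hw) h).2
      have heq : nbrIn G (farIn G R u) w = nbrIn G R w :=
        Finset.eq_of_subset_of_card_le (Finset.filter_subset_filter _ hsub)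
          (by rw [hu2 w hw]; exact hle)
      have : y ∈ nbrIn G (farIn G R u) w := heq ▸ mem_nbrIn.2 ⟨hy, hwy⟩
      exact (mem_nbrIn.1 this).1

end Finset

/-- a finite connected simple graph on `n` vertices with
`Δ(G) ≥ n - 9` has `c_L(G) ≤ 3`. -/
theorem lazyCopNumber_le_three_of_maxDegree_ge
    {V : Type*} [Fintype V] (G : SimpleGraph V) [DecidableRel G.Adj]
    (hconn : G.Connected) (hΔ : Fintype.card V - 9 ≤ G.maxDegree) :
    lazyCopNumber G ≤ 3 := by
  classical
  have := hconn.nonempty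
  obtain ⟨v, hv⟩ := G.exists_maximal_degree_vertex
  refine Nat.sInf_le ⟨fun _ => v, fun r => ?_⟩
  by_cases hr : v = r ∨ G.Adj v r
  · exact .of_attacked 0 hr
  refine Confined.win_of_card_le_eight hconn (farIn G Finset.univ v) ?_ _ ?_ r
    (by simpa using hr)
  · have h1 := card_farIn_add (G := G) (Finset.mem_univ v)
    have h2 : (nbrIn G Finset.univ v).card = G.degree v := by
      rw [← G.card_neighborFinset_eq_degree, G.neighborFinset_eq_filter, nbrIn]
    rw [Finset.card_univ] at h1
    omega
  · intro s _ s' _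
    by_cases hs' : v = s' ∨ G.Adj v s'
    · exact .inr ⟨0, rfl, hs'⟩
    · exact .inl (by simpa using hs')

end CopsRobbers
end

section
/- For every n ≥ 2, n − 1 lazy cops do not have a winning strategy on the n×n rooks graph K_n □ K_n; that is, the robber can evade n − 1 lazy cops indefinitely, so c_L(K_n □ K_n) ≥ n. -/
/-!
Cops and robbers on a simple graph `G`.

A *configuration* consists of the positions of the `k` cops (a function
`Fin k → V`) together with the robber's position, with the cops to move.
The cops win if at some point a cop occupies the robber's vertex.
-/

namespace CopsRobbers

variable {V : Type*}

/-- With `k < n` cops on an `n`-element set of lines, some line carries no cop. -/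
theorem exists_forall_ne_of_lt {k n : ℕ} (h : k < n) (f : Fin k → Fin n) :
    ∃ x, ∀ i, f i ≠ x := by
  by_contra! hf
  have := Fintype.card_le_of_surjective f hf
  simp only [Fintype.card_fin] at this
  omega

theorem rooksGraph_adj {n : ℕ} {x y : Fin n × Fin n} :
    (rooksGraph n).Adj x y ↔ x.1 ≠ y.1 ∧ x.2 = y.2 ∨ x.2 ≠ y.2 ∧ x.1 = y.1 := by
  simp [rooksGraph, SimpleGraph.boxProd_adj]

/-- Fewer than `n` lazy cops cannot catch a robber whose row and column are free of cops:
after a cop's move, his row or his column is still free, and moving along it he reaches a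
vertex with free row and free column. -/
theorem not_lazyWinFrom_rooksGraph {n k : ℕ} (h : k < n) {c : Fin k → Fin n × Fin n}
    {r : Fin n × Fin n} (hr : ∀ i, (c i).1 ≠ r.1 ∧ (c i).2 ≠ r.2) :
    ¬ LazyWinFrom (rooksGraph n) c r := by
  have lazy_move {c c' : Fin k → Fin n × Fin n} {r : Fin n × Fin n} {j : Fin k}
      (hmove : c' j = c j ∨ (rooksGraph n).Adj (c j) (c' j)) (hfix : ∀ i, i ≠ j → c' i = c i)
      (hr : ∀ i, (c i).1 ≠ r.1 ∧ (c i).2 ≠ r.2) :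
      (∀ i, (c' i).1 ≠ r.1) ∨ ∀ i, (c' i).2 ≠ r.2 := by
    rw [rooksGraph_adj] at hmove
    have hj := hr j
    by_cases hrow : (c' j).1 = r.1
    · right
      intro i
      by_cases hi : i = j
      · subst hi
        grind
      · rw [hfix i hi]
        exact (hr i).2
    · left
      intro i
      by_cases hi : i = j
      · rwa [hi]
      · rw [hfix i hi]
        exact (hr i).1
  intro hwin
  induction hwin with
  | caught i hi => exact (hr i).1 (by rw [hi])
  | stepCatch c' j hmove hfix i hi =>
    rcases lazy_move hmove hfix hr with hfree | hfree <;> exact hfree i (by rw [hi])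
  | @step c r c' j hmove hfix _ ih =>
    rcases lazy_move hmove hfix hr with hfree | hfree
    · obtain ⟨y, hy⟩ := exists_forall_ne_of_lt h fun i => (c' i).2
      refine ih (r.1, y) ?_ fun i => ⟨hfree i, hy i⟩
      rw [rooksGraph_adj, Prod.ext_iff]
      grind
    · obtain ⟨x, hx⟩ := exists_forall_ne_of_lt h fun i => (c' i).1
      refine ih (x, r.2) ?_ fun i => ⟨hx i, hfree i⟩
      rw [rooksGraph_adj, Prod.ext_iff]
      grind

theorem not_lazyCopsWin_rooksGraph {n k : ℕ} (h : k < n) : ¬ LazyCopsWin (rooksGraph n) k := by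
  rintro ⟨c, hc⟩
  obtain ⟨x, hx⟩ := exists_forall_ne_of_lt h fun i => (c i).1
  obtain ⟨y, hy⟩ := exists_forall_ne_of_lt h fun i => (c i).2
  exact not_lazyWinFrom_rooksGraph h (r := (x, y)) (fun i => ⟨hx i, hy i⟩) (hc _)

/-- On a finite graph, placing a cop on every vertex wins. -/
theorem lazyCopsWin_card [Fintype V] (G : SimpleGraph V) : LazyCopsWin G (Fintype.card V) :=
  ⟨(Fintype.equivFin V).symm, fun r => .caught (Fintype.equivFin V r) (by simp)⟩

/-- for `n ≥ 2`, `n - 1` lazy cops do not have a winning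
strategy on the `n × n` rooks graph, so `c_L(K_n □ K_n) ≥ n`. -/
theorem rooksGraph_not_lazyCopsWin_pred (n : ℕ) (hn : 2 ≤ n) :
    ¬ LazyCopsWin (rooksGraph n) (n - 1) ∧ n ≤ lazyCopNumber (rooksGraph n) := by
  refine ⟨not_lazyCopsWin_rooksGraph (by omega), ?_⟩
  refine le_csInf ⟨_, lazyCopsWin_card _⟩ fun k hk => ?_
  by_contra! hlt
  exact not_lazyCopsWin_rooksGraph hlt hk

end CopsRobbers
end
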